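/- arXiv:2108.07087 — 2 statements merged into one kernel-verified Lean document; each statement's English description precedes it below -/
import Mathlib

section
/- For every integer d ≥ 2 there exists an integer C_d with the following property: for every finite set S ⊆ ℝ^d in general position and every natural number N, there exists a finite set T ⊆ ℝ^d with S ⊆ T, |T| ≥ N, T in general position, and T is C_d-hole-free. -/
noncomputable section

/-- A set `S ⊆ ℝ^d` is in general position if for every `k < d`, every `k`-dimensional
affine subspace of `ℝ^d` contains at most `k + 1` points of `S`. -/
def InGeneralPosition (d : ℕ) (S : Set (EuclideanSpace ℝ (Fin d))) : Prop :=
  ∀ k : ℕ, k < d → ∀ V : AffineSubspace ℝ (EuclideanSpace ℝ (Fin d)),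
    Module.finrank ℝ V.direction = k → (S ∩ (V : Set (EuclideanSpace ℝ (Fin d)))).ncard ≤ k + 1

/-- A finite set `S ⊆ ℝ^d` is `ℓ`-hole-free if for every `ℓ` distinct points of `S` there is a
point of `S` lying in the interior of the convex hull of those points. -/
def HoleFree {d : ℕ} (ℓ : ℕ) (S : Set (EuclideanSpace ℝ (Fin d))) : Prop :=
  ∀ T : Set (EuclideanSpace ℝ (Fin d)), T ⊆ S → T.Finite → T.ncard = ℓ →
    ∃ s ∈ S, s ∈ interior (convexHull ℝ T)

namespace FH
open Finset

abbrev E (d : ℕ) := EuclideanSpace ℝ (Fin d)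
abbrev Pt (d : ℕ) := Fin d → ℤ
def emb {d : ℕ} (x : Pt d) : E d := WithLp.toLp 2 (fun i => (x i : ℝ))
def bas {d : ℕ} (i : Fin d) : E d := EuclideanSpace.single i 1
/-- coordinatewise congruence -/
def Cg {d : ℕ} (m : ℕ) (x y : Pt d) : Prop := ∀ i, (m : ℤ) ∣ x i - y i

lemma Cg.refl {d m : ℕ} (x : Pt d) : Cg m x x := fun i => by simp
lemma Cg.symm {d m : ℕ} {x y : Pt d} (h : Cg m x y) : Cg m y x := fun i => by
  rw [← neg_sub]; exact (dvd_neg).2 (h i)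
lemma Cg.trans {d m : ℕ} {x y z : Pt d} (h : Cg m x y) (h' : Cg m y z) : Cg m x z := fun i => by
  have := dvd_add (h i) (h' i)
  simpa using this
lemma Cg.mono {d m n : ℕ} {x y : Pt d} (hmn : n ∣ m) (h : Cg m x y) : Cg n x y := fun i =>
  (Int.natCast_dvd_natCast.2 hmn).trans (h i)

lemma pig {d : ℕ} (Q D : ℕ) (hQ : 0 < Q) (hD : 0 < D) (X : Finset (Pt d)) (hne : X.Nonempty)
    (hX : ∀ x ∈ X, ∀ y ∈ X, Cg Q x y) :
    ∃ X' ⊆ X, X'.Nonempty ∧ (∀ x ∈ X', ∀ y ∈ X', Cg (Q * D) x y) ∧ X.card ≤ D ^ d * X'.card := by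
  classical
  obtain ⟨x0, hx0⟩ := hne
  have : NeZero D := ⟨hD.ne'⟩
  let c : Pt d → (Fin d → ZMod D) := fun x i => (((x i - x0 i) / (Q : ℤ) : ℤ) : ZMod D)
  obtain ⟨v, -, hv⟩ := Finset.exists_max_image (univ : Finset (Fin d → ZMod D))
    (fun v => (X.filter (fun x => c x = v)).card) univ_nonempty
  have hcard : X.card ≤ D ^ d * (X.filter (fun x => c x = v)).card := by
    have := Finset.card_le_mul_card_image_of_maps_to (s := X) (t := (univ : Finset (Fin d → ZMod D)))
      (f := c) (fun _ _ => mem_univ _) _ (fun b _ => hv b (mem_univ _))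
    simpa [mul_comm, ZMod.card] using this
  refine ⟨X.filter (fun x => c x = v), filter_subset _ _, ?_, ?_, hcard⟩
  · rw [nonempty_iff_ne_empty]
    intro h
    rw [h] at hcard
    simp at hcard
    simp [hcard] at hx0
  · intro x hx y hy i
    rw [mem_filter] at hx hy
    have h1 : c x i = c y i := by rw [hx.2, hy.2]
    obtain ⟨a, ha⟩ := hX x hx.1 x0 hx0 i
    obtain ⟨b, hb⟩ := hX y hy.1 x0 hx0 i
    have hQ' : (Q : ℤ) ≠ 0 := by exact_mod_cast hQ.ne'
    simp only [c] at h1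
    rw [ha, hb, Int.mul_ediv_cancel_left _ hQ', Int.mul_ediv_cancel_left _ hQ',
      ZMod.intCast_eq_intCast_iff_dvd_sub] at h1
    have : x i - y i = Q * (a - b) := by linarith
    rw [this]
    push_cast
    apply mul_dvd_mul_left
    rw [← neg_sub]; exact (dvd_neg).2 h1

lemma split {d p : ℕ} (hp : 2 ≤ p) (X : Finset (Pt d)) (h2 : 2 ≤ X.card) :
    ∃ j, (∀ x ∈ X, ∀ y ∈ X, Cg (p ^ j) x y) ∧ ∃ X' ⊆ X, X'.Nonempty ∧
      (∀ x ∈ X', ∀ y ∈ X', Cg (p ^ (j+1)) x y) ∧ X.card ≤ p ^ d * X'.card ∧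
      ∃ z ∈ X, ∀ x ∈ X', ¬ Cg (p ^ (j+1)) z x := by
  classical
  have hex : ∃ j, ¬ ∀ x ∈ X, ∀ y ∈ X, Cg (p ^ (j+1)) x y := by
    obtain ⟨x, hx, y, hy, hxy⟩ := Finset.one_lt_card.1 h2
    obtain ⟨i, hi⟩ := Function.ne_iff.1 hxy
    refine ⟨(x i - y i).natAbs, fun h => ?_⟩
    have h3 := h x hx y hy i
    have h4 : x i - y i = 0 := by
      apply Int.eq_zero_of_abs_lt_dvd h3
      rw [Int.abs_eq_natAbs]
      have : (x i - y i).natAbs < p ^ ((x i - y i).natAbs + 1) :=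
        (Nat.lt_pow_self (by omega)).trans (Nat.pow_lt_pow_right (by omega) (by omega))
      exact_mod_cast this
    exact hi (by omega)
  let j := Nat.find hex
  have hj := Nat.find_spec hex
  have hjX : ∀ x ∈ X, ∀ y ∈ X, Cg (p ^ j) x y := by
    rcases Nat.eq_zero_or_pos j with h0 | h0
    · intro x _ y _ i
      simp [h0]
    · have := Nat.find_min hex (m := j - 1) (by change j - 1 < j; omega)
      rw [not_not, Nat.sub_add_cancel h0] at this
      exact this
  have hne : X.Nonempty := Finset.card_pos.1 (by omega)
  obtain ⟨X', hX', hne', hc, hcard⟩ := pig (p ^ j) p (by positivity) (by omega) X hne hjX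
  rw [← pow_succ] at hc
  refine ⟨j, hjX, X', hX', hne', hc, hcard, ?_⟩
  by_contra hcon
  push Not at hcon
  apply hj
  intro x hx y hy
  obtain ⟨x', hx', h1⟩ := hcon x hx
  obtain ⟨y', hy', h2⟩ := hcon y hy
  exact h1.trans ((hc x' hx' y' hy').trans h2.symm)

lemma heights {d : ℕ} (g : ℕ → Pt d → ℕ) (B : Finset (Pt d)) (J : ℕ) (Λ : ℝ) (hΛ : 1 ≤ Λ)
    (hJ : ∀ x ∈ B, ∀ y ∈ B, (∀ i < J, g i x = g i y) → x = y) :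
    ∃ f : Pt d → ℝ, ∃ M : ℝ, 1 ≤ M ∧ ∃ θ : ℕ → ℝ, (∀ j, 0 < θ j) ∧ (∀ x ∈ B, |f x| ≤ 1) ∧
      (∀ j, Λ * M * θ (j+1) ≤ θ j) ∧
      (∀ x ∈ B, ∀ y ∈ B, ∀ j, (∀ i < j, g i x = g i y) → |f x - f y| ≤ M * θ j) ∧
      (∀ x ∈ B, ∀ y ∈ B, ∀ j, (∀ i < j, g i x = g i y) → g j y < g j x → θ j ≤ f x - f y) := by
  classical
  let G : ℕ := ∑ j ∈ range J, ∑ x ∈ B, g j x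
  have hG : ∀ j < J, ∀ x ∈ B, g j x ≤ G := fun j hj x hx =>
    (Finset.single_le_sum (f := fun x => g j x) (fun _ _ => Nat.zero_le _) hx).trans
      (Finset.single_le_sum (f := fun j => ∑ x ∈ B, g j x) (fun _ _ => Nat.zero_le _)
        (mem_range.2 hj))
  let A : ℝ := J * G + 1
  have hA : 1 ≤ A := by
    have : (0:ℝ) ≤ J * G := by positivity
    simp only [A]; linarith
  have hA0 : 0 < A := by linarith
  let t : ℝ := 1 / (2 * Λ * A)
  have ht0 : 0 < t := by positivity
  have htA : t * A ≤ 1 / 2 := by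
    have : t * A = 1 / (2 * Λ) := by simp only [t]; field_simp
    rw [this]
    apply one_div_le_one_div_of_le <;> linarith
  have ht1 : t ≤ 1 := by nlinarith
  let f0 : Pt d → ℝ := fun x => ∑ j ∈ range J, t ^ j * g j x
  -- tail bound
  have tail : ∀ x ∈ B, ∀ y ∈ B, ∀ j, |∑ i ∈ Ico j J, t ^ i * ((g i x : ℝ) - g i y)| ≤ A * t ^ j := by
    intro x hx y hy j
    calc |∑ i ∈ Ico j J, t ^ i * ((g i x : ℝ) - g i y)|
        ≤ ∑ i ∈ Ico j J, |t ^ i * ((g i x : ℝ) - g i y)| := abs_sum_le_sum_abs _ _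
      _ ≤ ∑ i ∈ Ico j J, t ^ j * G := by
          apply sum_le_sum
          intro i hi
          rw [mem_Ico] at hi
          rw [abs_mul, abs_of_pos (pow_pos ht0 i)]
          apply mul_le_mul (pow_le_pow_of_le_one ht0.le ht1 hi.1) _ (abs_nonneg _) (by positivity)
          have h1 : (g i x : ℝ) ≤ G := by exact_mod_cast hG i hi.2 x hx
          have h2 : (g i y : ℝ) ≤ G := by exact_mod_cast hG i hi.2 y hy
          have h3 : (0:ℝ) ≤ g i x := by positivity
          have h4 : (0:ℝ) ≤ g i y := by positivity
          rw [abs_le]; constructor <;> linarith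
      _ ≤ A * t ^ j := by
          rw [sum_const, Nat.card_Ico, nsmul_eq_mul]
          have h1 : ((J - j : ℕ) : ℝ) ≤ J := by exact_mod_cast Nat.sub_le _ _
          have h2 : (0:ℝ) ≤ t ^ j * G := by positivity
          have h3 : (0:ℝ) < t ^ j := by positivity
          simp only [A]
          nlinarith [mul_le_mul_of_nonneg_right h1 h2]
  have diff : ∀ x y : Pt d, ∀ j < J, (∀ i < j, g i x = g i y) →
      f0 x - f0 y = ∑ i ∈ Ico j J, t ^ i * ((g i x : ℝ) - g i y) := by
    intro x y j hj h
    simp only [f0]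
    rw [← sum_sub_distrib, ← sum_range_add_sum_Ico _ hj.le, sum_eq_zero, zero_add]
    · exact sum_congr rfl fun i _ => by ring
    · intro i hi
      rw [h i (mem_range.1 hi)]; ring
  refine ⟨fun x => f0 x / A, 2 * A, by linarith, fun j => t ^ j / 2 / A, fun j => by positivity,
    ?_, ?_, ?_, ?_⟩
  · intro x hx
    rw [abs_div, abs_of_pos hA0, div_le_one hA0]
    simp only [f0]
    calc |∑ j ∈ range J, t ^ j * (g j x : ℝ)| ≤ ∑ j ∈ range J, |t ^ j * (g j x : ℝ)| :=
          abs_sum_le_sum_abs _ _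
      _ ≤ ∑ j ∈ range J, (G : ℝ) := by
          apply sum_le_sum
          intro i hi
          rw [abs_of_nonneg (by positivity)]
          have h1 : (g i x : ℝ) ≤ G := by exact_mod_cast hG i (mem_range.1 hi) x hx
          have h2 : t ^ i ≤ 1 := pow_le_one₀ ht0.le ht1
          have h3 : (0:ℝ) ≤ g i x := by positivity
          nlinarith
      _ ≤ A := by simp [A]
  · intro j
    have : Λ * (2 * A) * (t ^ (j+1) / 2 / A) = (2 * Λ * A * t) * (t ^ j / 2 / A) := by ring
    rw [this]
    have h2 : 2 * Λ * A * t = 1 := by simp only [t]; field_simp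
    rw [h2, one_mul]
  · intro x hx y hy j h
    have e : 2 * A * (t ^ j / 2 / A) = A * t ^ j / A := by ring
    rw [e, ← sub_div, abs_div, abs_of_pos hA0]
    apply div_le_div_of_nonneg_right _ hA0.le
    rcases lt_or_ge j J with hj | hj
    · rw [diff x y j hj h]
      exact tail x hx y hy j
    · have := hJ x hx y hy (fun i hi => h i (hi.trans_le hj))
      rw [this]; simp; positivity
  · intro x hx y hy j h hlt
    rcases lt_or_ge j J with hj | hj
    · rw [← sub_div]
      apply div_le_div_of_nonneg_right _ hA0.le
      rw [diff x y j hj h, sum_eq_sum_Ico_succ_bot hj]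
      have h1 := (abs_le.1 (tail x hx y hy (j+1))).1
      have h2 : (1:ℝ) ≤ (g j x : ℝ) - g j y := by
        have : (g j y : ℝ) + 1 ≤ g j x := by exact_mod_cast hlt
        linarith
      have h3 : (0:ℝ) < t ^ j := by positivity
      have h4 : A * t ^ (j+1) ≤ t ^ j / 2 := by
        have : A * t ^ (j+1) = (t * A) * t ^ j := by ring
        rw [this]; nlinarith
      nlinarith
    · have := hJ x hx y hy (fun i hi => h i (hi.trans_le hj))
      rw [this] at hlt; omega

end FH
namespace FH
open Finset

def box (d n : ℕ) : Finset (Pt d) := Fintype.piFinset (fun _ => Finset.Icc 0 (n : ℤ))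
lemma mem_box {d n : ℕ} {x : Pt d} : x ∈ box d n ↔ ∀ i, 0 ≤ x i ∧ x i ≤ n := by
  simp [box, Fintype.mem_piFinset]

/-- the affine hull of a finite set of lattice points -/
def hul {d : ℕ} (X : Finset (Pt d)) : AffineSubspace ℝ (E d) :=
  affineSpan ℝ (emb '' (X : Set (Pt d)))

open Classical in
def NN {d : ℕ} (B X : Finset (Pt d)) (l : E d →ₗ[ℝ] ℝ) : ℝ :=
  ∑ b ∈ B.filter (fun b => emb b ∈ hul X), ∑ c ∈ B.filter (fun b => emb b ∈ hul X),
    |l (emb b) - l (emb c)|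

def SS {d : ℕ} (s : ℕ) (l : E d →ₗ[ℝ] ℝ) : ℝ :=
  ∑ i ∈ (univ : Finset (Fin d)).filter (fun i => i.val < s), |l (bas i)|

def Good {d : ℕ} (B : Finset (Pt d)) (φ : Pt d → E d) (s : ℕ) (X : Finset (Pt d)) (y : Pt d)
    (C : ℝ) : Prop :=
  ∀ (l : E d →ₗ[ℝ] ℝ) (m : ℝ), (∀ a ∈ X, l (φ a) - l (φ y) ≤ m) → NN B X l + SS s l ≤ C * m

lemma NN_nonneg {d : ℕ} (B X : Finset (Pt d)) (l : E d →ₗ[ℝ] ℝ) : 0 ≤ NN B X l :=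
  sum_nonneg fun _ _ => sum_nonneg fun _ _ => abs_nonneg _

lemma SS_nonneg {d : ℕ} (s : ℕ) (l : E d →ₗ[ℝ] ℝ) : 0 ≤ SS s l :=
  sum_nonneg fun _ _ => abs_nonneg _

lemma le_NN {d : ℕ} {B X : Finset (Pt d)} (l : E d →ₗ[ℝ] ℝ) {b c : Pt d} (hb : b ∈ B)
    (hb' : emb b ∈ hul X) (hc : c ∈ B) (hc' : emb c ∈ hul X) :
    |l (emb b) - l (emb c)| ≤ NN B X l := by
  classical
  unfold NN
  refine le_trans ?_ (Finset.single_le_sum (f := fun b => ∑ c ∈ B.filter (fun b => emb b ∈ hul X),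
    |l (emb b) - l (emb c)|) (fun _ _ => sum_nonneg fun _ _ => abs_nonneg _)
    (mem_filter.2 ⟨hb, hb'⟩))
  exact Finset.single_le_sum (f := fun c => |l (emb b) - l (emb c)|) (fun _ _ => abs_nonneg _)
    (mem_filter.2 ⟨hc, hc'⟩)

lemma SS_succ {d s : ℕ} (hs : s < d) (l : E d →ₗ[ℝ] ℝ) :
    SS (s+1) l = SS s l + |l (bas ⟨s, hs⟩)| := by
  classical
  unfold SS
  have : (univ : Finset (Fin d)).filter (fun i => i.val < s + 1)
      = insert ⟨s, hs⟩ ((univ : Finset (Fin d)).filter (fun i => i.val < s)) := by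
    ext i
    simp only [mem_filter, mem_univ, true_and, mem_insert, Fin.ext_iff]
    omega
  rw [this, sum_insert (by simp), add_comm]

lemma ctrl {d : ℕ} {κ : Type*} [Fintype κ] (u : κ → E d) (μ : κ → ℝ) (hμ : ∀ a, 0 < μ a)
    (h0 : ∑ a, μ a • u a = 0) [Nonempty κ] (n : E d) (hn : n ∈ Submodule.span ℝ (Set.range u)) :
    ∃ C : ℝ, 0 ≤ C ∧ ∀ (l : E d →ₗ[ℝ] ℝ) (m : ℝ), (∀ a, l (u a) ≤ m) → |l n| ≤ C * m := by
  classical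
  have hsum : ∀ l : E d →ₗ[ℝ] ℝ, ∑ a, μ a * l (u a) = 0 := by
    intro l
    have := congrArg l h0
    simpa using this
  have hpos : 0 < ∑ a, μ a := sum_pos (fun a _ => hμ a) univ_nonempty
  have hm : ∀ (l : E d →ₗ[ℝ] ℝ) (m : ℝ), (∀ a, l (u a) ≤ m) → 0 ≤ m := by
    intro l m h
    have h1 : ∑ a, μ a * l (u a) ≤ ∑ a, μ a * m :=
      sum_le_sum fun a _ => mul_le_mul_of_nonneg_left (h a) (hμ a).le
    rw [hsum l, ← sum_mul] at h1
    exact nonneg_of_mul_nonneg_right h1 hpos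
  induction hn using Submodule.span_induction with
  | mem x hx =>
    obtain ⟨a, rfl⟩ := hx
    refine ⟨1 + (∑ b, μ b) / μ a, by have := hμ a; positivity, fun l m h => ?_⟩
    have hm0 := hm l m h
    have ha := hμ a
    have h1 : -(l (u a)) ≤ (∑ b, μ b) / μ a * m := by
      rw [div_mul_eq_mul_div, le_div_iff₀ ha]
      have h2 := hsum l
      rw [← add_sum_erase _ _ (mem_univ a)] at h2
      have h3 : ∑ b ∈ univ.erase a, μ b * l (u b) ≤ ∑ b ∈ univ.erase a, μ b * m :=
        sum_le_sum fun b _ => mul_le_mul_of_nonneg_left (h b) (hμ b).le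
      have h4 : ∑ b ∈ univ.erase a, μ b * m ≤ ∑ b, μ b * m :=
        sum_le_sum_of_subset_of_nonneg (erase_subset _ _)
          (fun b _ _ => mul_nonneg (hμ b).le hm0)
      rw [sum_mul]
      nlinarith
    have h5 : 0 ≤ (∑ b, μ b) / μ a * m := by positivity
    rw [abs_le]; constructor <;> linarith [h a]
  | zero => exact ⟨0, le_rfl, fun l m _ => by simp⟩
  | add x y _ _ hx hy =>
    obtain ⟨C1, h1, hC1⟩ := hx
    obtain ⟨C2, h2, hC2⟩ := hy
    refine ⟨C1 + C2, by positivity, fun l m h => ?_⟩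
    rw [map_add, add_mul]
    exact (abs_add_le _ _).trans (add_le_add (hC1 l m h) (hC2 l m h))
  | smul c x _ hx =>
    obtain ⟨C1, h1, hC1⟩ := hx
    refine ⟨|c| * C1, by positivity, fun l m h => ?_⟩
    rw [map_smul, smul_eq_mul, abs_mul, mul_assoc]
    exact mul_le_mul_of_nonneg_left (hC1 l m h) (abs_nonneg _)

lemma emb_inj {d : ℕ} : Function.Injective (emb (d := d)) := by
  intro x y h
  ext i
  have := congrArg (fun v : E d => v i) h
  simpa [emb] using this

lemma stage0 {d n : ℕ} (X : Finset (Pt d)) (hXB : X ⊆ box d n) (hne : X.Nonempty)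
    (Q : ℕ) (hX : ∀ x ∈ X, ∀ y ∈ X, Cg (Q * (d+1)) x y) (w : Pt d) (hw : emb w ∈ hul X) :
    ∃ y ∈ box d n, Cg Q y w ∧ emb y ∈ hul X ∧ ∃ C > 0, Good (box d n) emb 0 X y C := by
  classical
  obtain ⟨t, htX, htspan, htind⟩ := exists_affineIndependent ℝ (E d) (emb '' (X : Set (Pt d)))
  have htfin : t.Finite := (X.finite_toSet.image _).subset htX
  have : Fintype t := htfin.fintype
  have htne : t.Nonempty := by
    rw [← affineSpan_nonempty ℝ, htspan, affineSpan_nonempty]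
    exact (Finset.coe_nonempty.2 hne).image _
  have : Nonempty t := htne.to_subtype
  have hcard : Fintype.card t ≤ d + 1 := by
    have := htind.card_le_finrank_succ
    refine this.trans ?_
    have h2 := Submodule.finrank_le (vectorSpan ℝ (Set.range ((↑) : t → E d)))
    simpa using h2
  have hpt : ∀ a : t, ∃ x ∈ X, emb x = a := fun a => by
    obtain ⟨x, hx, h⟩ := htX a.2
    exact ⟨x, hx, h⟩
  choose pt hptX hpt using hpt
  have hw' : emb w ∈ affineSpan ℝ (Set.range ((↑) : t → E d)) := by
    rw [Subtype.range_coe, htspan]; exact hw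
  obtain ⟨lam, hlam1, hlam⟩ := eq_affineCombination_of_mem_affineSpan_of_fintype hw'
  rw [Finset.affineCombination_eq_linear_combination _ _ _ hlam1] at hlam
  have hlami : ∀ i, (w i : ℝ) = ∑ a : t, lam a * (pt a i : ℝ) := by
    intro i
    have := congrArg (fun v : E d => v i) hlam
    simp only [emb, WithLp.ofLp_sum, Finset.sum_apply, WithLp.ofLp_smul, Pi.smul_apply,
      smul_eq_mul] at this
    rw [this]
    apply sum_congr rfl
    intro a _
    rw [← hpt a]; simp [emb]
  obtain ⟨a0⟩ := ‹Nonempty t›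
  have hu : ∀ a : t, ∃ u : Pt d, ∀ i, pt a i - pt a0 i = ((Q * (d+1) : ℕ) : ℤ) * u i := by
    intro a
    have := hX _ (hptX a) _ (hptX a0)
    choose u hu using this
    exact ⟨u, hu⟩
  choose u hu using hu
  let k : t → ℤ := fun a => ⌊-(lam a * (d+1))⌋ + 1
  let K : t → ℤ := fun a => if a = a0 then - ∑ b ∈ univ.erase a0, k b else k a
  have hK0 : ∑ a, K a = 0 := by
    rw [← add_sum_erase _ _ (mem_univ a0)]
    have : ∑ a ∈ univ.erase a0, K a = ∑ a ∈ univ.erase a0, k a :=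
      sum_congr rfl fun a ha => by simp [K, (mem_erase.1 ha).1]
    rw [this]; simp [K]
  have hD : (0:ℝ) < (d:ℝ) + 1 := by positivity
  let μ : t → ℝ := fun a => lam a + K a / (d+1)
  have hμ1 : ∑ a, μ a = 1 := by
    simp only [μ]
    rw [sum_add_distrib, hlam1, ← sum_div]
    have : ∑ a, (K a : ℝ) = 0 := by exact_mod_cast hK0
    rw [this]; simp
  have hk : ∀ a ≠ a0, 0 < μ a ∧ μ a ≤ 1 / (d+1) := by
    intro a ha
    have e : μ a = (lam a * (d+1) + (⌊-(lam a * (d+1))⌋ + 1 : ℤ)) / (d+1) := by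
      simp only [μ, K, k, if_neg ha]
      field_simp
    rw [e]
    have h1 := Int.lt_floor_add_one (-(lam a * (d+1)))
    have h2 := Int.floor_le (-(lam a * (d+1)))
    constructor
    · apply div_pos _ hD
      push_cast; linarith
    · apply div_le_div_of_nonneg_right _ hD.le
      push_cast; linarith
  have hμ : ∀ a, 0 < μ a := by
    intro a
    by_cases ha : a = a0
    · subst ha
      rw [← add_sum_erase _ _ (mem_univ a)] at hμ1
      have h1 : ∑ b ∈ univ.erase a, μ b ≤ ∑ b ∈ univ.erase a, (1:ℝ) / (d+1) :=
        sum_le_sum fun b hb => (hk b (mem_erase.1 hb).1).2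
      rw [sum_const, card_erase_of_mem (mem_univ _), nsmul_eq_mul, card_univ] at h1
      have h2 : ((Fintype.card t - 1 : ℕ) : ℝ) ≤ d := by exact_mod_cast (by omega)
      have h3 : (d:ℝ) * (1 / (d+1)) < 1 := by
        rw [mul_one_div, div_lt_one hD]; linarith
      have h4 : ((Fintype.card t - 1 : ℕ) : ℝ) * (1 / (d+1)) ≤ (d:ℝ) * (1 / (d+1)) :=
        mul_le_mul_of_nonneg_right h2 (by positivity)
      linarith
    · exact (hk a ha).1
  let y : Pt d := fun i => w i + ∑ a, K a * (Q * u a i)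
  have hyi : ∀ i, (y i : ℝ) = ∑ a, μ a * (pt a i : ℝ) := by
    intro i
    simp only [y, μ]
    push_cast
    rw [hlami i]
    simp only [add_mul, sum_add_distrib]
    congr 1
    have h1 : ∑ a, (K a : ℝ) / (d+1) * (pt a0 i : ℝ) = 0 := by
      rw [← sum_mul, ← sum_div]
      have : ∑ a, (K a : ℝ) = 0 := by exact_mod_cast hK0
      rw [this]; simp
    rw [← sub_zero (∑ a, (K a : ℝ) / (d+1) * (pt a i : ℝ)), ← h1, ← sum_sub_distrib]
    apply sum_congr rfl
    intro a _
    have h2 : (pt a i : ℝ) - pt a0 i = (Q * (d+1)) * u a i := by exact_mod_cast hu a i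
    rw [← mul_sub, h2]
    field_simp
  have hy : emb y = ∑ a : t, μ a • (a : E d) := by
    ext i
    simp only [emb, WithLp.ofLp_sum, Finset.sum_apply, WithLp.ofLp_smul, Pi.smul_apply,
      smul_eq_mul]
    rw [hyi i]
    apply sum_congr rfl
    intro a _
    rw [← hpt a]; simp [emb]
  have hyspan : emb y ∈ hul X := by
    unfold hul
    rw [← htspan, ← Subtype.range_coe (s := t), hy,
      ← Finset.affineCombination_eq_linear_combination _ _ _ hμ1]
    exact affineCombination_mem_affineSpan hμ1 _
  refine ⟨y, ?_, ?_, hyspan, ?_⟩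
  · rw [mem_box]
    intro i
    constructor
    · have : (0:ℝ) ≤ y i := by
        rw [hyi]
        apply sum_nonneg
        intro a _
        have := (mem_box.1 (hXB (hptX a)) i).1
        exact mul_nonneg (hμ a).le (by exact_mod_cast this)
      exact_mod_cast this
    · have : (y i : ℝ) ≤ n := by
        rw [hyi]
        calc ∑ a, μ a * (pt a i : ℝ) ≤ ∑ a, μ a * (n:ℝ) := by
              apply sum_le_sum
              intro a _
              have := (mem_box.1 (hXB (hptX a)) i).2
              exact mul_le_mul_of_nonneg_left (by exact_mod_cast this) (hμ a).le
          _ = n := by rw [← sum_mul, hμ1, one_mul]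
      exact_mod_cast this
  · intro i
    simp only [y, add_sub_cancel_left]
    apply dvd_sum
    intro a _
    exact Dvd.dvd.mul_left (dvd_mul_right _ _) _
  · have h0 : ∑ a : t, μ a • ((a : E d) - emb y) = 0 := by
      simp only [smul_sub, sum_sub_distrib, ← hy, ← sum_smul, hμ1, one_smul, sub_self]
    have : Nonempty t := ⟨a0⟩
    have key : ∀ b c : Pt d, emb b ∈ hul X → emb c ∈ hul X → ∃ C : ℝ, 0 ≤ C ∧
        ∀ (l : E d →ₗ[ℝ] ℝ) (m : ℝ), (∀ a : t, l ((a : E d) - emb y) ≤ m) →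
          |l (emb b - emb c)| ≤ C * m := by
      intro b c hb hc
      apply ctrl (fun a : t => (a : E d) - emb y) μ hμ h0
      have h1 : emb b - emb c ∈ (hul X).direction := AffineSubspace.vsub_mem_direction hb hc
      unfold hul at h1
      rw [← htspan, direction_affineSpan, vectorSpan_def] at h1
      refine Submodule.span_le.2 ?_ h1
      rintro _ ⟨p, hp, q, hq, rfl⟩
      have e : p -ᵥ q = (p - emb y) - (q - emb y) := by simp
      rw [SetLike.mem_coe]
      change p -ᵥ q ∈ _
      rw [e]
      exact Submodule.sub_mem _ (Submodule.subset_span ⟨⟨p, hp⟩, rfl⟩)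
        (Submodule.subset_span ⟨⟨q, hq⟩, rfl⟩)
    have key' : ∀ b c : Pt d, ∃ C : ℝ, emb b ∈ hul X → emb c ∈ hul X →
        ∀ (l : E d →ₗ[ℝ] ℝ) (m : ℝ), (∀ a : t, l ((a : E d) - emb y) ≤ m) →
          |l (emb b - emb c)| ≤ C * m := by
      intro b c
      by_cases h : emb b ∈ hul X ∧ emb c ∈ hul X
      · obtain ⟨C, _, hC⟩ := key b c h.1 h.2
        exact ⟨C, fun _ _ => hC⟩
      · exact ⟨0, fun h1 h2 => absurd ⟨h1, h2⟩ h⟩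
    choose C hC using key'
    refine ⟨1 + ∑ b ∈ (box d n).filter (fun b => emb b ∈ hul X),
      ∑ c ∈ (box d n).filter (fun b => emb b ∈ hul X), |C b c|, ?_, fun l m h => ?_⟩
    · have : 0 ≤ ∑ b ∈ (box d n).filter (fun b => emb b ∈ hul X),
        ∑ c ∈ (box d n).filter (fun b => emb b ∈ hul X), |C b c| :=
        sum_nonneg fun _ _ => sum_nonneg fun _ _ => abs_nonneg _
      linarith
    have hS : SS 0 l = 0 := by simp [SS]
    have hla : ∀ a : t, l ((a : E d) - emb y) ≤ m := by
      intro a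
      rw [map_sub, ← hpt a]
      exact h _ (hptX a)
    have hm0 : 0 ≤ m := by
      have h1 : ∑ a : t, μ a * l ((a : E d) - emb y) = 0 := by
        have := congrArg l h0
        simpa using this
      have h2 : ∑ a : t, μ a * l ((a : E d) - emb y) ≤ ∑ a : t, μ a * m :=
        sum_le_sum fun a _ => mul_le_mul_of_nonneg_left (hla a) (hμ a).le
      rw [h1, ← sum_mul, hμ1, one_mul] at h2
      exact h2
    rw [hS, add_zero, add_mul, one_mul, sum_mul]
    refine le_add_of_nonneg_of_le hm0 ?_
    unfold NN
    apply sum_le_sum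
    intro b hb
    rw [sum_mul]
    apply sum_le_sum
    intro c hc
    rw [← map_sub]
    refine (hC b c (mem_filter.1 hb).2 (mem_filter.1 hc).2 l m hla).trans ?_
    exact mul_le_mul_of_nonneg_right (le_abs_self _) hm0

end FH
namespace FH
open Finset

def pr (s : ℕ) : ℕ := Nat.nth Nat.Prime s
lemma pr_prime (s : ℕ) : (pr s).Prime := Nat.prime_nth_prime s
lemma pr_coprime {s t : ℕ} (h : s ≠ t) : (pr s).Coprime (pr t) :=
  (Nat.coprime_primes (pr_prime s) (pr_prime t)).2
    (fun e => h (Nat.nth_injective Nat.infinite_setOfPred_prime e))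

def KK (d : ℕ) : ℕ → ℕ
  | 0 => 2 * (d+1) ^ d
  | s+1 => KK d s * ((pr s) ^ d) ^ 3

lemma KK_two (d s : ℕ) : 2 ≤ KK d s := by
  induction s with
  | zero => simp only [KK]; have : 0 < (d+1)^d := by positivity
            omega
  | succ s ih =>
    simp only [KK]
    have : 0 < ((pr s) ^ d) ^ 3 := by have := (pr_prime s).pos; positivity
    nlinarith

def Solid {d : ℕ} (K : ℕ) (X : Finset (Pt d)) : Prop :=
  K ≤ X.card ∧ ∀ X' ⊆ X, X.card ≤ K * X'.card → hul X' = hul X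

lemma Solid.sub {d K c : ℕ} {X X' : Finset (Pt d)} (h : Solid (K * c) X) (hX : X' ⊆ X)
    (hc : 0 < c) (hK : 0 < K) (hcard : X.card ≤ c * X'.card) : Solid K X' ∧ hul X' = hul X := by
  have h1 : hul X' = hul X := h.2 X' hX (by nlinarith [Nat.zero_le (c * X'.card)])
  refine ⟨⟨?_, ?_⟩, h1⟩
  · have := h.1
    have h2 : c * K ≤ c * X'.card := by nlinarith
    exact Nat.le_of_mul_le_mul_left h2 hc
  · intro Y hY hYc
    rw [h1]
    apply h.2 Y (hY.trans hX)
    calc X.card ≤ c * X'.card := hcard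
      _ ≤ c * (K * Y.card) := Nat.mul_le_mul_left _ hYc
      _ = K * c * Y.card := by ring

lemma NN_congr {d : ℕ} {B X X' : Finset (Pt d)} (h : hul X' = hul X) (l : E d →ₗ[ℝ] ℝ) :
    NN B X' l = NN B X l := by
  unfold NN; rw [h]

lemma Good.mono {d : ℕ} {B X : Finset (Pt d)} {φ : Pt d → E d} {s : ℕ} {y : Pt d} {C C' : ℝ}
    (hC : 0 < C) (hCC : C ≤ C') (h : Good B φ s X y C) : Good B φ s X y C' := by
  intro l m hm
  have h1 := h l m hm
  have h2 : 0 ≤ C * m := (add_nonneg (NN_nonneg B X l) (SS_nonneg s l)).trans h1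
  have h3 : 0 ≤ m := nonneg_of_mul_nonneg_right h2 hC
  nlinarith

lemma Good.super {d : ℕ} {B X X' : Finset (Pt d)} {φ : Pt d → E d} {s : ℕ} {y : Pt d} {C : ℝ}
    (hX : X' ⊆ X) (hh : hul X' = hul X) (h : Good B φ s X' y C) : Good B φ s X y C := by
  intro l m hm
  rw [← NN_congr hh]
  exact h l m (fun a ha => hm a (hX ha))

lemma uniform {d : ℕ} (B : Finset (Pt d)) (φ : Pt d → E d) (s : ℕ) :
    ∃ C : ℝ, 1 ≤ C ∧ ∀ X ⊆ B, ∀ y ∈ B, (∃ C > 0, Good B φ s X y C) → Good B φ s X y C := by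
  classical
  have : ∀ X y, ∃ C : ℝ, 0 < C ∧ ((∃ C > 0, Good B φ s X y C) → Good B φ s X y C) := by
    intro X y
    by_cases h : ∃ C > 0, Good B φ s X y C
    · obtain ⟨C, h1, h2⟩ := h
      exact ⟨C, h1, fun _ => h2⟩
    · exact ⟨1, one_pos, fun h' => absurd h' h⟩
  choose C hC0 hC using this
  refine ⟨1 + ∑ X ∈ B.powerset, ∑ y ∈ B, C X y, ?_, ?_⟩
  · have : 0 ≤ ∑ X ∈ B.powerset, ∑ y ∈ B, C X y :=
      sum_nonneg fun _ _ => sum_nonneg fun _ _ => (hC0 _ _).le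
    linarith
  · intro X hX y hy h
    apply (hC X y h).mono (hC0 X y)
    have h1 := Finset.single_le_sum (f := fun y => C X y) (fun _ _ => (hC0 _ _).le) hy
    have h2 := Finset.single_le_sum (f := fun X => ∑ y ∈ B, C X y)
      (fun _ _ => sum_nonneg fun _ _ => (hC0 _ _).le) (mem_powerset.2 hX)
    linarith

lemma step_real {N C m α μ κ lam : ℝ} (hN : 0 ≤ N) (hC : 1 ≤ C) (hμ : 0 < μ) (hμκ : μ ≤ κ)
    (hlam : 6 * C * κ ≤ lam)
    (h1 : α ≤ 0 → N ≤ C * (m + α * μ))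
    (h2 : 0 < α → N ≤ C * (m + α * κ))
    (h3 : 0 < α → α * lam ≤ m + 3 * N) :
    N + |α| ≤ (C + 1 / μ + 2 * (1 + 3 * C) / lam + (1 + 3 * C)) * m := by
  have hC0 : 0 < C := by linarith
  have hκ : 0 < κ := by linarith
  have hl : 0 < lam := by nlinarith [mul_pos hC0 hκ]
  rcases le_or_gt α 0 with ha | ha
  · have h := h1 ha
    rw [abs_of_nonpos ha]
    have hm' : 0 ≤ m + α * μ := nonneg_of_mul_nonneg_right (hN.trans h) hC0
    have h4 : -α ≤ 1 / μ * m := by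
      rw [div_mul_eq_mul_div, le_div_iff₀ hμ]; linarith
    have hm : 0 ≤ m := by nlinarith
    have h5 : N ≤ C * m := by nlinarith [mul_nonneg hC0.le (mul_nonneg (neg_nonneg.2 ha) hμ.le)]
    have h6 : 0 ≤ 2 * (1 + 3 * C) / lam * m := by positivity
    have h7 : 0 ≤ (1 + 3 * C) * m := by positivity
    linarith
  · have h := h2 ha
    have h' := h3 ha
    rw [abs_of_pos ha]
    have hx : α * (6 * C * κ) ≤ α * lam := mul_le_mul_of_nonneg_left hlam ha.le
    have h8 : α * lam ≤ 2 * (1 + 3 * C) * m := by nlinarith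
    have hm : 0 ≤ m := by
      have : 0 ≤ 2 * (1 + 3 * C) * m := le_trans (by positivity) h8
      exact nonneg_of_mul_nonneg_right this (by positivity)
    have h4 : α ≤ 2 * (1 + 3 * C) / lam * m := by
      rw [div_mul_eq_mul_div, le_div_iff₀ hl]; exact h8
    have h5 : N ≤ C * m + (1 + 3 * C) * m := by nlinarith
    have h6 : 0 ≤ 1 / μ * m := by positivity
    linarith

lemma step_good {d n s : ℕ} (hs : s < d) {φ : Pt d → E d} {f : Pt d → ℝ}
    (hφ : ∀ x ∈ box d n, ∀ l : E d →ₗ[ℝ] ℝ, |l (φ x) - l (emb x)| ≤ SS s l)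
    {X X' : Finset (Pt d)} (hXX : X' ⊆ X) (hne : X'.Nonempty) (hh : hul X' = hul X) {y z : Pt d}
    (hy : y ∈ box d n) (hy' : emb y ∈ hul X) (hzB : z ∈ box d n) (hz : z ∈ X)
    {C : ℝ} (hC : 1 ≤ C) (hg : Good (box d n) φ s X' y C)
    (σ : ℝ) (hσ : σ = 1 ∨ σ = -1) {μ κ lam : ℝ} (hμ : 0 < μ)
    (h1 : ∀ a ∈ X', μ ≤ σ * (f y - f a)) (h2 : ∀ a ∈ X', σ * (f y - f a) ≤ κ)
    (h3 : lam ≤ σ * (f z - f y)) (h4 : 6 * C * κ ≤ lam) :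
    ∃ C > 0, Good (box d n) (fun x => φ x + f x • bas ⟨s, hs⟩) (s+1) X y C := by
  obtain ⟨a0, ha0⟩ := hne
  have hκ : μ ≤ κ := (h1 a0 ha0).trans (h2 a0 ha0)
  have hκ0 : 0 < κ := by linarith
  have hl : 0 < lam := by nlinarith [mul_pos (by linarith : 0 < C) hκ0]
  refine ⟨(C + 1 / μ + 2 * (1 + 3 * C) / lam + (1 + 3 * C)), by positivity, fun l m hm => ?_⟩
  set e : E d := bas ⟨s, hs⟩ with he
  have hσσ : σ * σ = 1 := by rcases hσ with h | h <;> rw [h] <;> norm_num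
  have hσa : |l e| = |σ * l e| := by
    rw [abs_mul]; rcases hσ with h | h <;> rw [h] <;> simp
  have hm' : ∀ a ∈ X, l (φ a) - l (φ y) + (σ * l e) * (σ * (f a - f y)) ≤ m := by
    intro a ha
    have := hm a ha
    simp only [map_add, map_smul, smul_eq_mul] at this
    have e2 : (σ * l e) * (σ * (f a - f y)) = (σ * σ) * (l e * (f a - f y)) := by ring
    rw [e2, hσσ]
    linarith
  rw [SS_succ hs, ← add_assoc, hσa]
  have hN := add_nonneg (NN_nonneg (box d n) X l) (SS_nonneg s l)
  apply step_real hN hC hμ hκ h4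
  · intro ha
    rw [← NN_congr hh]
    apply hg l
    intro a haX
    have := hm' a (hXX haX)
    have h5 := h1 a haX
    nlinarith
  · intro ha
    rw [← NN_congr hh]
    apply hg l
    intro a haX
    have := hm' a (hXX haX)
    have h5 := h2 a haX
    nlinarith
  · intro ha
    have h5 := hm' z hz
    have h6 := abs_le.1 (hφ y hy l)
    have h7 := abs_le.1 (hφ z hzB l)
    have hz' : emb z ∈ hul X := subset_affineSpan _ _ ⟨z, hz, rfl⟩
    have h8 := abs_le.1 (le_NN l hzB hz' hy hy')
    have h9 := NN_nonneg (box d n) X l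
    have h10 := SS_nonneg s l
    nlinarith [mul_le_mul_of_nonneg_left h3 ha.le]

def PP (d n s : ℕ) (φ : Pt d → E d) : Prop :=
  (∀ x ∈ box d n, ∀ l : E d →ₗ[ℝ] ℝ, |l (φ x) - l (emb x)| ≤ SS s l) ∧
  ∀ X ⊆ box d n, Solid (KK d s) X → ∀ Q : ℕ, 0 < Q → (∀ i < s, Q.Coprime (pr i)) →
    (∀ x ∈ X, ∀ y ∈ X, Cg Q x y) → ∀ w, emb w ∈ hul X →
    ∃ y ∈ box d n, Cg Q y w ∧ emb y ∈ hul X ∧ ∃ C > 0, Good (box d n) φ s X y C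

lemma PP_zero (d n : ℕ) : PP d n 0 emb := by
  refine ⟨fun x _ l => by simpa using SS_nonneg 0 l, ?_⟩
  intro X hX hsol Q hQ _ hc w hw
  have hK := KK_two d 0
  have hne : X.Nonempty := Finset.card_pos.1 (by have := hsol.1; omega)
  obtain ⟨X', hX', hne', hc', hcard⟩ := pig Q (d+1) hQ (by omega) X hne hc
  obtain ⟨-, hh⟩ := Solid.sub (K := 2) (c := (d+1)^d) hsol hX' (by positivity) (by omega) hcard
  obtain ⟨y, hy, hy1, hy2, C, hC, hg⟩ := stage0 X' (hX'.trans hX) hne' Q hc' w (by rw [hh]; exact hw)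
  exact ⟨y, hy, hy1, by rw [← hh]; exact hy2, C, hC, hg.super hX' hh⟩

lemma emb_line {d : ℕ} (w z : Pt d) (c : ℤ) :
    emb (fun i => w i + c * (z i - w i)) = AffineMap.lineMap (emb w) (emb z) (c : ℝ) := by
  ext i
  simp [emb, AffineMap.lineMap_apply]
  ring

lemma chain {d p : ℕ} (hp : 2 ≤ p) (g : ℕ → Pt d → ℕ) (X : Finset (Pt d))
    (hc : 2 * (p ^ d) ^ 3 ≤ X.card) :
    ∃ X' ⊆ X, X'.Nonempty ∧ X.card ≤ (p ^ d) ^ 3 * X'.card ∧ ∃ a0 ∈ X', ∃ j j' z z', j < j' ∧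
      z ∈ X ∧ z' ∈ X ∧ (∀ a ∈ X', Cg (p ^ j) z a ∧ ¬ Cg (p ^ (j+1)) z a) ∧
      (∀ a ∈ X', Cg (p ^ j') z' a ∧ ¬ Cg (p ^ (j'+1)) z' a) ∧
      (∀ a ∈ X', ∀ b ∈ X', Cg (p ^ (j'+1)) a b) ∧
      (g j a0 < g j z ↔ g j' a0 < g j' z') := by
  have hp0 : 0 < p ^ d := by positivity
  have hp1 : 1 ≤ p ^ d := hp0
  have hA : 2 ≤ X.card := by nlinarith [Nat.one_le_pow 3 _ hp0]
  obtain ⟨j1, hj1, X1, hX1, hn1, hc1, hk1, z1, hz1, hnz1⟩ := split hp X hA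
  have hA1 : 2 * (p^d)^2 ≤ X1.card := by
    have : p ^ d * (2 * (p^d)^2) ≤ p ^ d * X1.card := by
      calc p ^ d * (2 * (p^d)^2) = 2 * (p ^ d) ^ 3 := by ring
        _ ≤ _ := hc.trans hk1
    exact Nat.le_of_mul_le_mul_left this hp0
  obtain ⟨j2, hj2, X2, hX2, hn2, hc2, hk2, z2, hz2, hnz2⟩ := split hp X1
    (by nlinarith [Nat.one_le_pow 2 _ hp0])
  have hA2 : 2 * (p^d) ≤ X2.card := by
    have : p ^ d * (2 * (p^d)) ≤ p ^ d * X2.card := by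
      calc p ^ d * (2 * (p^d)) = 2 * (p ^ d) ^ 2 := by ring
        _ ≤ _ := hA1.trans hk2
    exact Nat.le_of_mul_le_mul_left this hp0
  obtain ⟨j3, hj3, X3, hX3, hn3, hc3, hk3, z3, hz3, hnz3⟩ := split hp X2 (by omega)
  obtain ⟨a0, ha0⟩ := hn3
  have l12 : j1 < j2 := by
    by_contra hcon
    push Not at hcon
    exact hnz2 a0 (hX3 ha0) ((hc1 z2 hz2 a0 (hX2 (hX3 ha0))).mono (pow_dvd_pow _ (by omega)))
  have l23 : j2 < j3 := by
    by_contra hcon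
    push Not at hcon
    exact hnz3 a0 ha0 ((hc2 z3 hz3 a0 ((hX3 ha0))).mono (pow_dvd_pow _ (by omega)))
  have hX30 := hX3.trans (hX2.trans hX1)
  refine ⟨X3, hX30, ⟨a0, ha0⟩, ?_, a0, ha0, ?_⟩
  · calc X.card ≤ p^d * X1.card := hk1
      _ ≤ p^d * (p^d * X2.card) := Nat.mul_le_mul_left _ hk2
      _ ≤ p^d * (p^d * (p^d * X3.card)) := Nat.mul_le_mul_left _ (Nat.mul_le_mul_left _ hk3)
      _ = _ := by ring
  have f1 : ∀ a ∈ X3, Cg (p ^ j1) z1 a ∧ ¬ Cg (p ^ (j1+1)) z1 a := fun a ha =>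
    ⟨hj1 z1 hz1 a (hX30 ha), hnz1 a (hX2 (hX3 ha))⟩
  have f2 : ∀ a ∈ X3, Cg (p ^ j2) z2 a ∧ ¬ Cg (p ^ (j2+1)) z2 a := fun a ha =>
    ⟨hj2 z2 hz2 a (hX2 (hX3 ha)), hnz2 a ((hX3 ha))⟩
  have f3 : ∀ a ∈ X3, Cg (p ^ j3) z3 a ∧ ¬ Cg (p ^ (j3+1)) z3 a := fun a ha =>
    ⟨hj3 z3 hz3 a (hX3 ha), hnz3 a ha⟩
  have c2 : ∀ a ∈ X3, ∀ b ∈ X3, Cg (p ^ (j2+1)) a b := fun a ha b hb =>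
    hc2 a (hX3 ha) b (hX3 hb)
  have m2 := hX1 hz2
  have m3 := hX1 (hX2 hz3)
  by_cases q1 : g j1 a0 < g j1 z1 <;> by_cases q2 : g j2 a0 < g j2 z2 <;>
    by_cases q3 : g j3 a0 < g j3 z3
  · exact ⟨j1, j2, z1, z2, l12, hz1, m2, f1, f2, c2, by tauto⟩
  · exact ⟨j1, j2, z1, z2, l12, hz1, m2, f1, f2, c2, by tauto⟩
  · exact ⟨j1, j3, z1, z3, l12.trans l23, hz1, m3, f1, f3, hc3, by tauto⟩
  · exact ⟨j2, j3, z2, z3, l23, m2, m3, f2, f3, hc3, by tauto⟩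
  · exact ⟨j2, j3, z2, z3, l23, m2, m3, f2, f3, hc3, by tauto⟩
  · exact ⟨j1, j3, z1, z3, l12.trans l23, hz1, m3, f1, f3, hc3, by tauto⟩
  · exact ⟨j1, j2, z1, z2, l12, hz1, m2, f1, f2, c2, by tauto⟩
  · exact ⟨j1, j2, z1, z2, l12, hz1, m2, f1, f2, c2, by tauto⟩

lemma exists_g (d p : ℕ) : ∃ g : ℕ → Pt d → ℕ, ∀ j x y, g j x = g j y ↔ Cg (p ^ (j+1)) x y := by
  refine ⟨fun j x => Encodable.encode (fun i => x i % ((p ^ (j+1) : ℕ) : ℤ)), fun j x y => ?_⟩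
  rw [Encodable.encode_inj, funext_iff]
  apply forall_congr'
  intro i
  rw [← Int.ModEq, Int.modEq_comm, Int.modEq_iff_dvd]

lemma PP_succ {d n s : ℕ} (hs : s < d) {φ : Pt d → E d} (h : PP d n s φ) :
    ∃ φ', PP d n (s+1) φ' := by
  obtain ⟨h1, h2⟩ := h
  obtain ⟨C, hC, hCu⟩ := uniform (box d n) φ s
  have hp := pr_prime s
  set p := pr s with hpdef
  obtain ⟨g, hg⟩ := exists_g d p
  have hJ : ∀ x ∈ box d n, ∀ y ∈ box d n, (∀ i < n+1, g i x = g i y) → x = y := by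
    intro x hx y hy hxy
    have h3 := (hg n x y).1 (hxy n (by omega))
    ext i
    have h4 : x i - y i = 0 := by
      apply Int.eq_zero_of_abs_lt_dvd (h3 i)
      have h5 : n < p ^ (n+1) :=
        (Nat.lt_pow_self hp.one_lt).trans (Nat.pow_lt_pow_right hp.one_lt (by omega))
      have h6 : (n:ℤ) < ((p ^ (n+1) : ℕ) : ℤ) := by exact_mod_cast h5
      have h7 := mem_box.1 hx i
      have h8 := mem_box.1 hy i
      rw [abs_lt]; constructor <;> linarith
    omega
  obtain ⟨f, M, hM, θ, hθ, hf1, hθs, hfu, hfl⟩ := heights g (box d n) (n+1) (6 * C) (by linarith) hJ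
  have hanti : Antitone θ := antitone_nat_of_succ_le fun j => by
    have := hθs j
    have h3 := hθ (j+1)
    have h4 : 1 ≤ 6 * C * M := by nlinarith
    nlinarith
  refine ⟨fun x => φ x + f x • bas ⟨s, hs⟩, ?_, ?_⟩
  · intro x hx l
    rw [SS_succ hs, map_add, map_smul, smul_eq_mul]
    have e : l (φ x) + f x * l (bas ⟨s, hs⟩) - l (emb x)
      = (l (φ x) - l (emb x)) + f x * l (bas ⟨s, hs⟩) := by ring
    rw [e]
    refine (abs_add_le _ _).trans (add_le_add (h1 x hx l) ?_)
    rw [abs_mul]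
    exact mul_le_of_le_one_left (abs_nonneg _) (hf1 x hx)
  · intro X hX hsol Q hQ hQc hXQ w hw
    have hK := KK_two d s
    obtain ⟨X', hX', hne', hcard, a0, ha0, j, j', z, z', hjj, hz, hz', hzj, hzj', hcg, hsgn⟩ :=
      chain hp.two_le g X (le_trans (Nat.mul_le_mul_right _ hK) hsol.1)
    obtain ⟨hsol', hh⟩ := Solid.sub (K := KK d s) (c := (p ^ d)^3) hsol hX'
      (by have := hp.pos; positivity) (by omega) hcard
    set P := p ^ (j'+1) with hP
    have hcop : Nat.Coprime Q P := (hQc s (by omega)).pow_right _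
    have hcop' : IsCoprime (Q : ℤ) (P : ℤ) := Nat.isCoprime_iff_coprime.2 hcop
    obtain ⟨u, v, huv⟩ := id hcop'
    have hzh' : emb z' ∈ hul X := subset_affineSpan _ _ ⟨z', hz', rfl⟩
    let w' : Pt d := fun i => w i + (u * Q) * (z' i - w i)
    have hw' : emb w' ∈ hul X' := by
      rw [hh]
      have := emb_line w z' (u * Q)
      simp only [w']
      rw [this]
      exact AffineMap.lineMap_mem _ hw hzh'
    obtain ⟨y, hy, hyc, hyh, hgood⟩ := h2 X' (hX'.trans hX) hsol' (Q * P)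
      (by have := hp.pos; positivity)
      (by
        intro i hi
        apply Nat.Coprime.mul_left (hQc i (by omega))
        exact (pr_coprime (by omega)).pow_left _)
      (by
        intro x hx x' hx' i
        push_cast
        exact hcop'.mul_dvd (hXQ x (hX' hx) x' (hX' hx') i) (hcg x hx x' hx' i))
      w' hw'
    have hgood' := hCu X' (hX'.trans hX) y hy hgood
    have hyw : Cg Q y w := (hyc.mono (dvd_mul_right _ _)).trans fun i => by
      have : w' i - w i = Q * (u * (z' i - w i)) := by simp only [w']; ring
      rw [this]; exact dvd_mul_right _ _
    have hyz : Cg P y z' := (hyc.mono (dvd_mul_left _ _)).trans fun i => by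
      have : w' i - z' i = P * (v * (w i - z' i)) := by
        simp only [w']
        have : (v * P : ℤ) = 1 - u * Q := by linarith
        calc w i + u * Q * (z' i - w i) - z' i = (1 - u * Q) * (w i - z' i) := by ring
          _ = _ := by rw [← this]; ring
      rw [this]; exact dvd_mul_right _ _
    have hyh' : emb y ∈ hul X := by rw [← hh]; exact hyh
    refine ⟨y, hy, hyw, hyh', ?_⟩
    have hya : ∀ a ∈ X', Cg (p ^ j') y a := fun a ha =>
      (hyz.mono (pow_dvd_pow _ (by omega))).trans (hzj' a ha).1
    have ag1 : ∀ a ∈ X', ∀ i < j', g i y = g i a := fun a ha i hi =>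
      (hg i y a).2 ((hya a ha).mono (pow_dvd_pow _ (by omega)))
    have ag2 : ∀ i < j, g i z = g i y := fun i hi =>
      (hg i z y).2 ((((hzj a0 ha0).1.mono (pow_dvd_pow _ (by omega)))).trans
        ((hya a0 ha0).symm.mono (pow_dvd_pow _ (by omega))))
    have e1 : g j' y = g j' z' := (hg _ _ _).2 hyz
    have e2 : ∀ a ∈ X', g j' a = g j' a0 := fun a ha => (hg _ _ _).2 (hcg a ha a0 ha0)
    have e3 : g j y = g j a0 := ag1 a0 ha0 j hjj
    have n1 : g j' z' ≠ g j' a0 := fun h => (hzj' a0 ha0).2 ((hg _ _ _).1 h)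
    have n2 : g j z ≠ g j a0 := fun h => (hzj a0 ha0).2 ((hg _ _ _).1 h)
    have hlam : 6 * C * (M * θ j') ≤ θ j := by
      have h3 := hθs j
      have h4 : θ j' ≤ θ (j+1) := hanti (by omega)
      calc 6 * C * (M * θ j') = 6 * C * M * θ j' := by ring
        _ ≤ 6 * C * M * θ (j+1) := mul_le_mul_of_nonneg_left h4 (by positivity)
        _ ≤ _ := h3
    have hub : ∀ a ∈ X', |f y - f a| ≤ M * θ j' := fun a ha =>
      hfu y hy a (hX (hX' ha)) j' (ag1 a ha)
    by_cases hq : g j a0 < g j z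
    · have hq' := hsgn.1 hq
      apply step_good hs h1 hX' hne' hh hy hyh' (hX hz) hz hC hgood' 1 (Or.inl rfl) (hθ j')
        (κ := M * θ j') (lam := θ j)
      · intro a ha
        rw [one_mul]
        exact hfl y hy a (hX (hX' ha)) j' (ag1 a ha) (by rw [e1, e2 a ha]; exact hq')
      · intro a ha
        rw [one_mul]
        exact (abs_le.1 (hub a ha)).2
      · rw [one_mul]
        exact hfl z (hX hz) y hy j ag2 (by rw [e3]; exact hq)
      · exact hlam
    · have hq' : ¬ g j' a0 < g j' z' := fun h => hq (hsgn.2 h)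
      apply step_good hs h1 hX' hne' hh hy hyh' (hX hz) hz hC hgood' (-1) (Or.inr rfl) (hθ j')
        (κ := M * θ j') (lam := θ j)
      · intro a ha
        have := hfl a (hX (hX' ha)) y hy j' (fun i hi => (ag1 a ha i hi).symm)
          (by rw [e1, e2 a ha]; omega)
        linarith
      · intro a ha
        have := (abs_le.1 (hub a ha)).1
        linarith
      · have := hfl y hy z (hX hz) j (fun i hi => (ag2 i hi).symm) (by rw [e3]; omega)
        linarith
      · exact hlam

lemma PP_all (d n : ℕ) : ∀ s ≤ d, ∃ φ, PP d n s φ := by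
  intro s
  induction s with
  | zero => exact fun _ => ⟨_, PP_zero d n⟩
  | succ s ih =>
    intro hs
    obtain ⟨φ, h⟩ := ih (by omega)
    exact PP_succ (by omega) h

end FH
namespace FH
open Finset

lemma solid_exists {d K : ℕ} (hK : 1 ≤ K) : ∀ r : ℕ, ∀ X : Finset (Pt d), X.Nonempty →
    Module.finrank ℝ (hul X).direction ≤ r → K ^ (r+1) ≤ X.card → ∃ Y ⊆ X, Solid K Y := by
  intro r
  induction r with
  | zero =>
    intro X hne hr hc
    refine ⟨X, Subset.rfl, by simpa using hc, ?_⟩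
    intro X' hX' hcard
    by_contra hne'
    have h1 : hul X' < hul X :=
      lt_of_le_of_ne (affineSpan_mono ℝ (Set.image_mono (by exact_mod_cast hX'))) hne'
    have h2 : X'.Nonempty := by
      rw [← Finset.card_pos]
      have := Finset.card_pos.2 hne
      by_contra h
      have : X'.card = 0 := by omega
      rw [this] at hcard; omega
    have h3 : ((hul X' : AffineSubspace ℝ (E d)) : Set (E d)).Nonempty :=
      (affineSpan_nonempty ℝ).2 ((Finset.coe_nonempty.2 h2).image _)
    have h4 := Submodule.finrank_lt_finrank_of_lt (AffineSubspace.direction_lt_of_nonempty h1 h3)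
    omega
  | succ r ih =>
    intro X hne hr hc
    by_cases hs : Solid K X
    · exact ⟨X, Subset.rfl, hs⟩
    have hKX : K ≤ X.card := le_trans (Nat.le_self_pow (by omega) K) hc
    unfold Solid at hs
    push Not at hs
    obtain ⟨X', hX', hcard, hne'⟩ := hs hKX
    have h1 : hul X' < hul X :=
      lt_of_le_of_ne (affineSpan_mono ℝ (Set.image_mono (by exact_mod_cast hX'))) hne'
    have h2 : X'.Nonempty := by
      rw [← Finset.card_pos]
      have := Finset.card_pos.2 hne
      by_contra h
      have : X'.card = 0 := by omega
      rw [this] at hcard; omega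
    have h3 : ((hul X' : AffineSubspace ℝ (E d)) : Set (E d)).Nonempty :=
      (affineSpan_nonempty ℝ).2 ((Finset.coe_nonempty.2 h2).image _)
    have h4 := Submodule.finrank_lt_finrank_of_lt (AffineSubspace.direction_lt_of_nonempty h1 h3)
    obtain ⟨Y, hY, hYs⟩ := ih X' h2 (by omega) (by
      have : K * K ^ (r+1) ≤ K * X'.card := by
        rw [← pow_succ']; exact hc.trans hcard
      exact Nat.le_of_mul_le_mul_left this (by omega))
    exact ⟨Y, hY.trans hX', hYs⟩

lemma lin_expand {d : ℕ} (l : E d →ₗ[ℝ] ℝ) (v : E d) : l v = ∑ i, v i * l (bas i) := by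
  have h : v = ∑ i, v i • bas i := by
    ext j
    simp [bas, WithLp.ofLp_sum, Finset.sum_apply, Pi.single_apply]
  conv_lhs => rw [h]
  simp

lemma lin_bound {d : ℕ} (l : E d →ₗ[ℝ] ℝ) (v : E d) (η : ℝ) (hv : ∀ i, |v i| ≤ η) :
    |l v| ≤ η * SS d l := by
  have hS : SS d l = ∑ i, |l (bas i)| := by
    unfold SS
    congr 1
    ext i; simp
  rw [lin_expand, hS, mul_sum]
  refine (abs_sum_le_sum_abs _ _).trans (sum_le_sum fun i _ => ?_)
  rw [abs_mul]
  exact mul_le_mul_of_nonneg_right (hv i) (abs_nonneg _)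

lemma cube_open {d : ℕ} (q : E d) (r : ℝ) : IsOpen {q' : E d | ∀ i, |q' i - q i| < r} := by
  rw [Set.setOf_forall]
  apply isOpen_iInter_of_finite
  intro i
  exact isOpen_lt (by fun_prop) continuous_const

lemma robust {d n : ℕ} {φ : Pt d → E d} {X : Finset (Pt d)} {y : Pt d} {C : ℝ} (hX : X ⊆ box d n)
    (hne : X.Nonempty) (hy : y ∈ box d n) (hC : 0 < C) (hg : Good (box d n) φ d X y C)
    {η ε : ℝ} (hη : 0 < η) (hηC : 3 * C * η < 1) (hε : 0 < ε) (c : E d) (χ : Pt d → E d)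
    (hχ : ∀ x ∈ box d n, ∀ i, |χ x i - (c i + ε * φ x i)| ≤ ε * η) :
    χ y ∈ interior (convexHull ℝ (χ '' (X : Set (Pt d)))) := by
  rw [mem_interior]
  refine ⟨{q' : E d | ∀ i, |q' i - χ y i| < ε * η}, ?_, cube_open _ _, ?_⟩
  · intro q' hq'
    by_contra hcon
    have hfin : (χ '' (X : Set (Pt d))).Finite := X.finite_toSet.image _
    have hcl : IsClosed (convexHull ℝ (χ '' (X : Set (Pt d)))) := hfin.isClosed_convexHull ℝ
    obtain ⟨f, u, hf1, hf2⟩ := geometric_hahn_banach_closed_point (convex_convexHull ℝ _) hcl hcon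
    let l : E d →ₗ[ℝ] ℝ := f.toLinearMap
    have hl : ∀ v, f v = l v := fun _ => rfl
    have hd : ∀ x ∈ box d n, |l (χ x) - (l c + ε * l (φ x))| ≤ ε * η * SS d l := by
      intro x hx
      have := lin_bound l (χ x - (c + ε • φ x)) (ε * η) (fun i => by simpa using hχ x hx i)
      simpa using this
    have hq : |l q' - l (χ y)| ≤ ε * η * SS d l := by
      have := lin_bound l (q' - χ y) (ε * η) (fun i => by simpa using (hq' i).le)
      simpa using this
    have hlt : ∀ a ∈ X, l (χ a) < l q' := fun a ha =>
      (hf1 _ (subset_convexHull ℝ _ ⟨a, ha, rfl⟩)).trans hf2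
    have hm : ∀ a ∈ X, l (φ a) - l (φ y) ≤ 3 * η * SS d l := by
      intro a ha
      have h1 := abs_le.1 (hd a (hX ha))
      have h2 := abs_le.1 (hd y hy)
      have h3 := abs_le.1 hq
      have h4 := hlt a ha
      have : ε * (l (φ a) - l (φ y)) ≤ ε * (3 * η * SS d l) := by nlinarith
      exact le_of_mul_le_mul_left this hε
    have hG := hg l _ hm
    have hN := NN_nonneg (box d n) X l
    have hS := SS_nonneg d l
    have hS0 : SS d l = 0 := by nlinarith
    obtain ⟨a, ha⟩ := hne
    have h5 := hlt a ha
    have h6 := lin_bound l (χ a - q') (∑ i, |(χ a - q') i|)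
      (fun i => Finset.single_le_sum (f := fun i => |(χ a - q') i|) (fun _ _ => abs_nonneg _)
        (mem_univ i))
    rw [hS0, mul_zero, map_sub] at h6
    have := abs_le.1 h6
    linarith [this.1]
  · intro i
    simp; positivity

lemma lattice_main (d : ℕ) : ∃ K : ℕ, ∀ n : ℕ, ∃ φ : Pt d → E d,
    (∀ x ∈ box d n, ∀ i, |φ x i - x i| ≤ 1) ∧ ∃ η : ℝ, 0 < η ∧ η ≤ 1 ∧
    ∀ ε : ℝ, 0 < ε → ∀ (c : E d) (χ : Pt d → E d),
      (∀ x ∈ box d n, ∀ i, |χ x i - (c i + ε * φ x i)| ≤ ε * η) →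
      ∀ X ⊆ box d n, K ≤ X.card →
        ∃ y ∈ box d n, χ y ∈ interior (convexHull ℝ (χ '' (X : Set (Pt d)))) := by
  refine ⟨KK d d ^ (d+1), fun n => ?_⟩
  have hK := KK_two d d
  obtain ⟨φ, h1, h2⟩ := PP_all d n d le_rfl
  obtain ⟨C, hC, hCu⟩ := uniform (box d n) φ d
  refine ⟨φ, ?_, 1 / (4 * C), by positivity, ?_, ?_⟩
  · intro x hx i
    let l : E d →ₗ[ℝ] ℝ := (EuclideanSpace.proj i : E d →L[ℝ] ℝ).toLinearMap
    have hl : ∀ v : E d, l v = v i := fun _ => rfl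
    have := h1 x hx l
    rw [hl, hl] at this
    refine this.trans ?_
    unfold SS
    have : ∀ j : Fin d, |l (bas j)| = if j = i then 1 else 0 := by
      intro j
      rw [hl]
      simp only [bas, EuclideanSpace.single_apply]
      by_cases h : j = i
      · simp [h]
      · simp [h, Ne.symm h]
    simp only [this]
    rw [Finset.sum_ite_eq']
    split_ifs <;> norm_num
  · rw [div_le_one (by positivity)]; linarith
  · intro ε hε c χ hχ X hX hcard
    have hne : X.Nonempty := by
      rw [← Finset.card_pos]
      have : 0 < KK d d ^ (d+1) := by positivity
      omega
    have hfr : Module.finrank ℝ (hul X).direction ≤ d := by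
      have := Submodule.finrank_le (hul X).direction
      simpa using this
    obtain ⟨Y, hYX, hYs⟩ := solid_exists (by omega) d X hne hfr hcard
    have hYne : Y.Nonempty := by
      rw [← Finset.card_pos]; have := hYs.1; omega
    obtain ⟨w, hw⟩ := hYne
    obtain ⟨y, hy, -, -, hg⟩ := h2 Y (hYX.trans hX) hYs 1 one_pos (fun i _ => Nat.coprime_one_left _)
      (fun x _ y _ i => by simp) w (subset_affineSpan _ _ ⟨w, hw, rfl⟩)
    refine ⟨y, hy, ?_⟩
    have := robust (hYX.trans hX) ⟨w, hw⟩ hy (by linarith) (hCu Y (hYX.trans hX) y hy hg)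
      (η := 1 / (4 * C)) (by positivity) (by
        have : 3 * C * (1 / (4 * C)) = 3 / 4 := by field_simp
        rw [this]; norm_num) hε c χ hχ
    exact interior_mono (convexHull_mono (Set.image_mono (by exact_mod_cast hYX))) this

lemma gp_insert {d : ℕ} {S : Set (E d)} (hfin : S.Finite) (hS : InGeneralPosition d S) (p : E d)
    (hp : ∀ A ⊆ S, A.ncard ≤ d → p ∉ affineSpan ℝ A) : InGeneralPosition d (insert p S) := by
  intro k hk V hV
  by_cases hpV : p ∈ V
  · rw [Set.insert_inter_of_mem (by exact hpV)]
    have h1 := hS k hk V hV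
    rcases Nat.lt_or_ge (S ∩ (V : Set (E d))).ncard (k+1) with h2 | h2
    · exact (Set.ncard_insert_le _ _).trans (by omega)
    exfalso
    have hA : (S ∩ (V : Set (E d))).Nonempty := by
      rw [← Set.ncard_pos (hfin.inter_of_left _)]; omega
    have hpA := hp (S ∩ V) Set.inter_subset_left (by omega)
    have hle : affineSpan ℝ (S ∩ (V : Set (E d))) ≤ V := affineSpan_le.2 Set.inter_subset_right
    have hlt : affineSpan ℝ (S ∩ (V : Set (E d))) < V :=
      lt_of_le_of_ne hle (fun e => hpA (by rw [e]; exact hpV))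
    have h4 := Submodule.finrank_lt_finrank_of_lt
      (AffineSubspace.direction_lt_of_nonempty hlt ((affineSpan_nonempty ℝ).2 hA))
    rw [hV] at h4
    have h5 := hS _ (h4.trans hk) (affineSpan ℝ (S ∩ (V : Set (E d)))) rfl
    have h6 : (S ∩ (V : Set (E d))).ncard ≤
        (S ∩ (affineSpan ℝ (S ∩ (V : Set (E d))) : Set (E d))).ncard :=
      Set.ncard_le_ncard (Set.subset_inter Set.inter_subset_left (subset_affineSpan ℝ _))
        (hfin.inter_of_left _)
    omega
  · rw [Set.insert_inter_of_notMem (by exact hpV)]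
    exact hS k hk V hV

lemma span_ne_top {d : ℕ} {A : Set (E d)} (hA : A.Finite) (hc : A.ncard ≤ d) :
    affineSpan ℝ A ≠ ⊤ := by
  intro h
  have : Fintype A := hA.fintype
  rcases A.eq_empty_or_nonempty with h0 | h0
  · rw [h0] at h
    simp at h
  · have hpos := (Set.ncard_pos hA).2 h0
    have h1 : Module.finrank ℝ (vectorSpan ℝ (Set.range ((↑) : A → E d))) ≤ A.ncard - 1 := by
      apply finrank_vectorSpan_range_le
      rw [← Nat.card_eq_fintype_card, Nat.card_coe_set_eq]
      omega
    rw [Subtype.range_coe, ← direction_affineSpan, h, AffineSubspace.direction_top,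
      finrank_top] at h1
    simp at h1
    omega

lemma pick {d : ℕ} {S : Set (E d)} (hfin : S.Finite) (t : E d) (δ : ℝ) (hδ : 0 < δ) :
    ∃ p : E d, (∀ i, |p i - t i| ≤ δ) ∧ ∀ A ⊆ S, A.ncard ≤ d → p ∉ affineSpan ℝ A := by
  by_contra hcon
  push Not at hcon
  let U : Set (E d) := {q' : E d | ∀ i, |q' i - t i| < δ}
  let F : Set (Set (E d)) := {A | A ⊆ S ∧ A.ncard ≤ d}
  have hF : F.Finite := hfin.finite_subsets.subset (fun A hA => hA.1)
  have hsub : U ⊆ ⋃ A ∈ F, (affineSpan ℝ A : Set (E d)) := by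
    intro q hq
    obtain ⟨A, h1, h2, h3⟩ := hcon q (fun i => (hq i).le)
    exact Set.mem_biUnion (show A ∈ F from ⟨h1, h2⟩) h3
  have h0 : MeasureTheory.volume (⋃ A ∈ F, (affineSpan ℝ A : Set (E d))) = 0 := by
    rw [MeasureTheory.measure_biUnion_null_iff hF.countable]
    intro A hA
    exact MeasureTheory.Measure.addHaar_affineSubspace _ _
      (span_ne_top (hfin.subset hA.1) hA.2)
  have h1 : MeasureTheory.volume U = 0 := MeasureTheory.measure_mono_null hsub h0
  have h2 : U = ∅ := ((cube_open t δ).measure_eq_zero_iff _).1 h1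
  have h3 : t ∈ U := fun i => by simpa using hδ
  rw [h2] at h3
  exact h3

lemma gp_extend {d : ℕ} (hd : 1 ≤ d) {S : Set (E d)} (hfin : S.Finite)
    (hS : InGeneralPosition d S) (t : Pt d → E d) (δ : ℝ) (hδ : 0 < δ) (B : Finset (Pt d)) :
    ∃ χ : Pt d → E d, Set.InjOn χ B ∧ InGeneralPosition d (S ∪ χ '' (B : Set (Pt d))) ∧
      ∀ x ∈ B, ∀ i, |χ x i - t x i| ≤ δ := by
  classical
  induction B using Finset.induction_on with
  | empty => exact ⟨t, by simp, by simpa using hS, by simp⟩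
  | insert x B hx ih =>
    obtain ⟨χ, h1, h2, h3⟩ := ih
    have hfin' : (S ∪ χ '' (B : Set (Pt d))).Finite := hfin.union (B.finite_toSet.image _)
    obtain ⟨p, hp1, hp2⟩ := pick hfin' (t x) δ hδ
    have hpn : p ∉ S ∪ χ '' (B : Set (Pt d)) := fun h =>
      hp2 {p} (by simpa using h) (by simpa using hd) (subset_affineSpan ℝ _ rfl)
    have heq : ∀ b ∈ B, Function.update χ x p b = χ b := fun b hb =>
      Function.update_of_ne (fun e : b = x => hx (by rw [← e]; exact hb)) _ _
    have himg : Function.update χ x p '' (B : Set (Pt d)) = χ '' (B : Set (Pt d)) :=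
      Set.image_congr heq
    refine ⟨Function.update χ x p, ?_, ?_, ?_⟩
    · rw [Finset.coe_insert, Set.injOn_insert (by simpa using hx)]
      refine ⟨h1.congr (fun b hb => (heq b hb).symm), ?_⟩
      rw [himg, Function.update_self]
      exact fun h => hpn (Or.inr h)
    · rw [Finset.coe_insert, Set.image_insert_eq, himg, Function.update_self, Set.union_insert]
      exact gp_insert hfin' h2 p hp2
    · intro b hb i
      rcases Finset.mem_insert.1 hb with h | h
      · rw [h, Function.update_self]; exact hp1 i
      · rw [heq b h]; exact h3 b h i

lemma simplex_interior {d : ℕ} {S : Set (E d)} (hfin : S.Finite) (hS : InGeneralPosition d S)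
    (A : Set (E d)) (hA : A ⊆ S) (hc : A.ncard = d + 1) : (interior (convexHull ℝ A)).Nonempty := by
  rw [interior_convexHull_nonempty_iff_affineSpan_eq_top]
  by_contra h
  have hne : A.Nonempty := by
    rw [← Set.ncard_pos (hfin.subset hA)]; omega
  have h1 := Submodule.finrank_lt_finrank_of_lt (AffineSubspace.direction_lt_of_nonempty
    (lt_top_iff_ne_top.2 h) ((affineSpan_nonempty ℝ).2 hne))
  rw [AffineSubspace.direction_top, finrank_top] at h1
  simp only [finrank_euclideanSpace, Fintype.card_fin] at h1
  have h2 := hS _ h1 (affineSpan ℝ A) rfl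
  have h3 : A.ncard ≤ (S ∩ (affineSpan ℝ A : Set (E d))).ncard :=
    Set.ncard_le_ncard (Set.subset_inter hA (subset_affineSpan ℝ _)) (hfin.inter_of_left _)
  omega

lemma cube_in {d : ℕ} {U : Set (E d)} (hU : IsOpen U) (hne : U.Nonempty) :
    ∃ m : E d, ∃ r : ℝ, 0 < r ∧ ∀ q : E d, (∀ i, |q i - m i| < r) → q ∈ U := by
  obtain ⟨m, hm⟩ := hne
  obtain ⟨r, hr, hb⟩ := Metric.isOpen_iff.1 hU m hm
  refine ⟨m, r / (d+1), by positivity, fun q hq => hb ?_⟩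
  rw [Metric.mem_ball, dist_eq_norm]
  have h1 : ‖q - m‖ ≤ ∑ i, |q i - m i| := by
    have e : q - m = ∑ i, (q i - m i) • (bas i : E d) := by
      ext j
      simp [bas, WithLp.ofLp_sum, Finset.sum_apply, Pi.single_apply]
    rw [e]
    refine (norm_sum_le _ _).trans (sum_le_sum fun i _ => ?_)
    rw [norm_smul]; simp [bas]
  have h2 : ∑ i, |q i - m i| ≤ ∑ i : Fin d, r / (d+1) := sum_le_sum fun i _ => (hq i).le
  have h3 : ∑ i : Fin d, r / ((d:ℝ)+1) < r := by
    simp only [sum_const, card_univ, Fintype.card_fin, nsmul_eq_mul]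
    rw [mul_div_assoc', div_lt_iff₀ (by positivity)]
    nlinarith
  linarith

lemma final (d : ℕ) (hd : 2 ≤ d) :
    ∃ C : ℕ, ∀ S : Set (E d), S.Finite → InGeneralPosition d S →
      ∀ N : ℕ, ∃ T : Set (E d),
        T.Finite ∧ S ⊆ T ∧ N ≤ T.ncard ∧ InGeneralPosition d T ∧ HoleFree C T := by
  classical
  obtain ⟨K, hK⟩ := lattice_main d
  refine ⟨K + d, fun S hfin hS N => ?_⟩
  let F : Set (Set (E d)) := {A | A ⊆ S ∧ A.ncard = d + 1}
  have hF : F.Finite := hfin.finite_subsets.subset (fun A hA => hA.1)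
  have hex : ∀ A : Set (E d), ∃ m : E d, ∃ r : ℝ, 0 < r ∧ (A ∈ F → ∀ q : E d,
      (∀ i, |q i - m i| < r) → q ∈ interior (convexHull ℝ A)) := by
    intro A
    by_cases hA : A ∈ F
    · obtain ⟨m, r, hr, h⟩ := cube_in isOpen_interior (simplex_interior hfin hS A hA.1 hA.2)
      exact ⟨m, r, hr, fun _ => h⟩
    · exact ⟨0, 1, one_pos, fun h => absurd h hA⟩
  choose m r hr hmr using hex
  obtain ⟨r0, hr0, hr0le⟩ : ∃ r0 : ℝ, 0 < r0 ∧ ∀ A ∈ F, r0 ≤ r A := by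
    rcases F.eq_empty_or_nonempty with h | h
    · exact ⟨1, one_pos, by simp [h]⟩
    · obtain ⟨A, _, hA'⟩ := Set.exists_min_image F r hF h
      exact ⟨r A, hr A, hA'⟩
  obtain ⟨R, hR⟩ : ∃ R : ℝ, ∀ A ∈ F, ∀ i, |m A i| ≤ R := by
    refine ⟨∑ A ∈ hF.toFinset, ∑ i, |m A i|, fun A hA i => ?_⟩
    exact (Finset.single_le_sum (f := fun i => |m A i|) (fun _ _ => abs_nonneg _)
      (mem_univ i)).trans (Finset.single_le_sum (f := fun A => ∑ i, |m A i|)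
      (fun _ _ => sum_nonneg fun _ _ => abs_nonneg _) (hF.mem_toFinset.2 hA))
  let ε : ℝ := r0 / 4
  have hε : 0 < ε := by positivity
  obtain ⟨n0, hn0⟩ := exists_nat_ge (2 * R / ε)
  let n := max n0 N
  obtain ⟨φ, hφ, η, hη, hη1, hmain⟩ := hK n
  let c : E d := WithLp.toLp 2 (fun _ => -R)
  have hc : ∀ i, c i = -R := fun i => rfl
  obtain ⟨χ, hinj, hgp, hχ⟩ := gp_extend (by omega) hfin hS (fun x => c + ε • φ x) (ε * η)
    (by positivity) (box d n)
  have hχ' : ∀ x ∈ box d n, ∀ i, |χ x i - (c i + ε * φ x i)| ≤ ε * η := fun x hx i => by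
    simpa using hχ x hx i
  have hm := hmain ε hε c χ hχ'
  have hTfin : (S ∪ χ '' (box d n : Set (Pt d))).Finite :=
    hfin.union ((box d n).finite_toSet.image _)
  refine ⟨S ∪ χ '' (box d n : Set (Pt d)), hTfin, Set.subset_union_left, ?_, hgp, ?_⟩
  · have h1 : (χ '' (box d n : Set (Pt d))).ncard = (n+1)^d := by
      rw [Set.ncard_image_of_injOn hinj, Set.ncard_coe_finset]
      simp [box, Fintype.card_piFinset]
    have h2 : (χ '' (box d n : Set (Pt d))).ncard ≤ (S ∪ χ '' (box d n : Set (Pt d))).ncard :=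
      Set.ncard_le_ncard Set.subset_union_right hTfin
    have h3 : n + 1 ≤ (n+1)^d := Nat.le_self_pow (by omega) _
    have h4 : N ≤ n := le_max_right _ _
    omega
  · intro T hT hTf hTc
    rcases Nat.lt_or_ge d (T ∩ S).ncard with h | h
    · obtain ⟨A, hA, hAc⟩ := Set.exists_subset_card_eq (s := T ∩ S) (n := d + 1) h
      have hAF : A ∈ F := ⟨hA.trans Set.inter_subset_right, hAc⟩
      let x : Pt d := fun i => ⌊(m A i + R) / ε⌋
      have hx : x ∈ box d n := by
        rw [mem_box]
        intro i
        have h1 := abs_le.1 (hR A hAF i)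
        constructor
        · apply Int.floor_nonneg.2
          apply div_nonneg _ hε.le
          linarith
        · have h2 : (x i : ℝ) ≤ n := by
            refine (Int.floor_le _).trans ?_
            have h3 : (m A i + R) / ε ≤ 2 * R / ε :=
              div_le_div_of_nonneg_right (by linarith) hε.le
            have h4 : (n0 : ℝ) ≤ n := by exact_mod_cast le_max_left n0 N
            linarith
          exact_mod_cast h2
      refine ⟨χ x, Or.inr ⟨x, hx, rfl⟩, interior_mono (convexHull_mono
        (hA.trans Set.inter_subset_left)) (hmr A hAF _ fun i => ?_)⟩
      have h1 := abs_le.1 (hχ' x hx i)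
      have h2 := abs_le.1 (hφ x hx i)
      have h3 : (x i : ℝ) * ε ≤ m A i + R := (le_div_iff₀ hε).1 (Int.floor_le _)
      have h4 : m A i + R < ((x i : ℝ) + 1) * ε := (div_lt_iff₀ hε).1 (Int.lt_floor_add_one _)
      have h5 := hr0le A hAF
      have h6 : r0 = 4 * ε := by simp only [ε]; ring
      rw [hc] at h1
      have h7 : ε * η ≤ ε := mul_le_of_le_one_right hε.le hη1
      have h8 := mul_le_mul_of_nonneg_left h2.1 hε.le
      have h9 := mul_le_mul_of_nonneg_left h2.2 hε.le
      rw [abs_lt]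
      constructor <;> nlinarith
    · have h1 : K ≤ (T \ S).ncard := by
        have := Set.ncard_inter_add_ncard_diff_eq_ncard T S hTf
        omega
      let X : Finset (Pt d) := (box d n).filter (fun x => χ x ∈ T \ S)
      have himg : χ '' (X : Set (Pt d)) = T \ S := by
        ext q
        constructor
        · rintro ⟨x, hx, rfl⟩
          exact (mem_filter.1 (Finset.mem_coe.1 hx)).2
        · intro hq
          rcases hT hq.1 with h2 | ⟨x, hx, rfl⟩
          · exact absurd h2 hq.2
          · exact ⟨x, Finset.mem_coe.2 (mem_filter.2 ⟨hx, hq⟩), rfl⟩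
      have hXc : K ≤ X.card := by
        have := Set.ncard_image_le (f := χ) X.finite_toSet
        rw [himg, Set.ncard_coe_finset] at this
        omega
      obtain ⟨y, hy, hyi⟩ := hm X (filter_subset _ _) hXc
      rw [himg] at hyi
      exact ⟨χ y, Or.inr ⟨y, hy, rfl⟩, interior_mono (convexHull_mono Set.diff_subset) hyi⟩

end FH
theorem statement0 (d : ℕ) (hd : 2 ≤ d) :
    ∃ C : ℕ, ∀ S : Set (EuclideanSpace ℝ (Fin d)), S.Finite → InGeneralPosition d S →
      ∀ N : ℕ, ∃ T : Set (EuclideanSpace ℝ (Fin d)),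
        T.Finite ∧ S ⊆ T ∧ N ≤ T.ncard ∧ InGeneralPosition d T ∧ HoleFree C T := by
  exact FH.final d hd
end
end

section
/- For every finite set S ⊆ ℝ² in general position and every natural number N, there exists a finite set T ⊆ ℝ² with S ⊆ T, |T| ≥ N, T in general position, and T is 9-hole-free. -/
noncomputable section

namespace HF

/-- linear functional, injective on the lattice -/
def ell (z : ℤ × ℤ) : ℝ := √2 * (z.1 : ℝ) - (z.2 : ℝ)
/-- parity class of a lattice point -/
def cls (z : ℤ × ℤ) : ℤ := 2 * (z.1 % 2) + z.2 % 2
def half (z : ℤ × ℤ) : ℤ × ℤ := (z.1 / 2, z.2 / 2)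
/-- recursively defined height function -/
def G (lam : ℝ) : ℕ → ℤ × ℤ → ℝ
  | 0, _ => 0
  | K + 1, z => (cls z : ℝ) + lam * G lam K (half z)
def D0 (a b c : ℤ × ℤ) : ℤ := (b.1 - a.1) * (c.2 - a.2) - (b.2 - a.2) * (c.1 - a.1)
def D1 (lam : ℝ) (K : ℕ) (a b c : ℤ × ℤ) : ℝ :=
  (ell b - ell a) * (G lam K c - G lam K a) - (ell c - ell a) * (G lam K b - G lam K a)
def InBox (K : ℕ) (z : ℤ × ℤ) : Prop := 0 ≤ z.1 ∧ z.1 < 2 ^ K ∧ 0 ≤ z.2 ∧ z.2 < 2 ^ K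
def Btw (p w r : ℤ × ℤ) : Prop :=
  ∃ m n : ℤ, 0 < m ∧ 0 < n ∧ (m + n) * w.1 = m * p.1 + n * r.1 ∧
    (m + n) * w.2 = m * p.2 + n * r.2

lemma ell_inj {a b : ℤ × ℤ} (h : ell a = ell b) : a = b := by
  unfold ell at h
  have h1 : √2 * ((a.1 - b.1 : ℤ) : ℝ) = ((a.2 - b.2 : ℤ) : ℝ) := by push_cast; linarith
  have h2 : a.1 - b.1 = 0 := by
    by_contra hne
    have := (irrational_sqrt_two.mul_intCast hne)
    exact this ⟨((a.2 - b.2 : ℤ) : ℚ), by rw [h1]; push_cast; rfl⟩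
  rw [h2] at h1
  have h3 : a.2 - b.2 = 0 := by
    have : ((a.2 - b.2 : ℤ) : ℝ) = 0 := by rw [← h1]; simp
    exact_mod_cast this
  exact Prod.ext (by omega) (by omega)

lemma cls_eq_iff {a b : ℤ × ℤ} : cls a = cls b ↔ a.1 % 2 = b.1 % 2 ∧ a.2 % 2 = b.2 % 2 := by
  unfold cls; omega

lemma three_cls {a b c : ℤ × ℤ} (h : D0 a b c = 0) :
    cls a = cls b ∨ cls b = cls c ∨ cls a = cls c := by
  have key : ∀ a1 a2 b1 b2 c1 c2 : ZMod 2,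
      (b1 - a1) * (c2 - a2) - (b2 - a2) * (c1 - a1) = 0 →
      (a1 = b1 ∧ a2 = b2) ∨ (b1 = c1 ∧ b2 = c2) ∨ (a1 = c1 ∧ a2 = c2) := by decide
  have h2 : ((D0 a b c : ℤ) : ZMod 2) = 0 := by rw [h]; simp
  unfold D0 at h2
  push_cast at h2
  have := key _ _ _ _ _ _ h2
  simp only [ZMod.intCast_eq_intCast_iff'] at this
  simp only [cls_eq_iff]
  exact this

lemma cls_bd (z : ℤ × ℤ) : 0 ≤ cls z ∧ cls z ≤ 3 := by unfold cls; omega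

lemma G_bd {lam : ℝ} (h0 : 0 < lam) (h1 : lam ≤ 1 / 2) (K : ℕ) (z : ℤ × ℤ) :
    0 ≤ G lam K z ∧ G lam K z ≤ 6 := by
  induction K generalizing z with
  | zero => simp [G]
  | succ K ih =>
    have := ih (half z)
    have hc := cls_bd z
    have c0 : (0 : ℝ) ≤ cls z := by exact_mod_cast hc.1
    have c1 : (cls z : ℝ) ≤ 3 := by exact_mod_cast hc.2
    simp only [G]
    constructor
    · nlinarith
    · nlinarith

lemma ratio1 {a b c : ℤ × ℤ} (h : D0 a b c = 0) :
    (ell b - ell a) * ((c.1 : ℝ) - a.1) = (ell c - ell a) * ((b.1 : ℝ) - a.1) := by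
  have h' : ((D0 a b c : ℤ) : ℝ) = 0 := by rw [h]; simp
  unfold D0 at h'; push_cast at h'
  unfold ell; linear_combination h'

lemma ratio2 {a b c : ℤ × ℤ} (h : D0 a b c = 0) :
    (ell b - ell a) * ((c.2 : ℝ) - a.2) = (ell c - ell a) * ((b.2 : ℝ) - a.2) := by
  have h' : ((D0 a b c : ℤ) : ℝ) = 0 := by rw [h]; simp
  unfold D0 at h'; push_cast at h'
  unfold ell; linear_combination √2 * h'

lemma D1_swap23 (lam : ℝ) (K) (a b c) : D1 lam K a c b = - D1 lam K a b c := by unfold D1; ring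
lemma D1_cyc (lam : ℝ) (K) (a b c) : D1 lam K b c a = D1 lam K a b c := by unfold D1; ring
lemma D0_swap23 (a b c) : D0 a c b = - D0 a b c := by unfold D0; ring
lemma D0_cyc (a b c) : D0 b c a = D0 a b c := by unfold D0; ring

lemma ell_ratio {K : ℕ} {a b c : ℤ × ℤ} (ha : InBox K a) (hc : InBox K c) (hab : a ≠ b)
    (h : D0 a b c = 0) : |ell c - ell a| ≤ 2 ^ K * |ell b - ell a| := by
  have aux : ∀ (x y u v : ℤ) (P Q : ℝ), 0 ≤ x → x < 2 ^ K → 0 ≤ y → y < 2 ^ K → u - x ≠ 0 →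
      P * ((y : ℝ) - x) = Q * ((u : ℝ) - x) → |Q| ≤ 2 ^ K * |P| := by
    intro x y u v P Q hx hx' hy hy' hu e
    have e2 := congrArg abs e
    rw [abs_mul, abs_mul] at e2
    have hu1 : (1 : ℝ) ≤ |(u : ℝ) - x| := by
      have := Int.one_le_abs hu
      exact_mod_cast this
    have hy1 : |(y : ℝ) - x| ≤ 2 ^ K := by
      have : |y - x| ≤ 2 ^ K := by rw [abs_le]; constructor <;> linarith
      exact_mod_cast this
    nlinarith [abs_nonneg P, abs_nonneg Q]
  by_cases h1 : b.1 - a.1 = 0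
  · have h2 : b.2 - a.2 ≠ 0 := fun h2 => hab (Prod.ext (by omega) (by omega))
    exact aux a.2 c.2 b.2 0 _ _ ha.2.2.1 ha.2.2.2 hc.2.2.1 hc.2.2.2 h2 (ratio2 h)
  · exact aux a.1 c.1 b.1 0 _ _ ha.1 ha.2.1 hc.1 hc.2.1 h1 (ratio1 h)

/-- the sign lemma -/
lemma signB {lam : ℝ} {K : ℕ} (h0 : 0 < lam) (h1 : 12 * lam * 2 ^ K < 1) {a b c : ℤ × ℤ}
    (ha : InBox K a) (hc : InBox K c) (hab : a ≠ b) (h : D0 a b c = 0)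
    (e1 : cls a = cls b) (e2 : cls a ≠ cls c) :
    0 < (ell b - ell a) * ((cls c : ℝ) - cls a) * D1 lam K a b c := by
  have hr := ell_ratio ha hc hab h
  cases K with
  | zero =>
    exfalso; apply e2
    unfold InBox at ha hc
    simp only [pow_zero] at ha hc
    rw [cls_eq_iff]; omega
  | succ K =>
    have hp : (1 : ℝ) ≤ 2 ^ (K + 1) := one_le_pow₀ (by norm_num)
    set M : ℝ := 2 ^ (K + 1)
    have hl : lam ≤ 1 / 2 := by nlinarith
    have ga := G_bd h0 hl K (half a)
    have gb := G_bd h0 hl K (half b)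
    have gc := G_bd h0 hl K (half c)
    set x := ell b - ell a with hx
    set y := ell c - ell a with hy
    have hx0 : 0 < |x| := by
      rw [abs_pos]; intro h; exact hab (ell_inj (by linarith)).symm
    have hD : D1 lam (K + 1) a b c = x * (((cls c : ℝ) - cls a) + lam * (G lam K (half c) - G lam K (half a))) - y * (lam * (G lam K (half b) - G lam K (half a))) := by
      unfold D1; simp only [G]; rw [← e1]; ring
    rw [hD]
    set d : ℝ := (cls c : ℝ) - cls a with hd
    have hd1 : 1 ≤ |d| := by
      have : (1 : ℤ) ≤ |cls c - cls a| := Int.one_le_abs (by omega)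
      rw [hd]; exact_mod_cast this
    set u := lam * (G lam K (half c) - G lam K (half a))
    set v := lam * (G lam K (half b) - G lam K (half a))
    have hu : |u| ≤ 6 * lam := by
      rw [abs_le]; constructor <;> simp only [u] <;> nlinarith
    have hv : |v| ≤ 6 * lam := by
      rw [abs_le]; constructor <;> simp only [v] <;> nlinarith
    have t1 : |x ^ 2 * d * u| ≤ |x| ^ 2 * |d| * (6 * lam) := by
      rw [abs_mul, abs_mul, abs_pow]; gcongr
    have t2 : |x * d * y * v| ≤ |x| * |d| * (M * |x|) * (6 * lam) := by
      rw [abs_mul, abs_mul, abs_mul]; gcongr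
    have t3 : x ^ 2 * d ^ 2 = |x| ^ 2 * |d| * |d| := by
      rw [← sq_abs x, ← sq_abs d]; ring
    have e : x * d * (x * (d + u) - y * v) = x ^ 2 * d ^ 2 + x ^ 2 * d * u - x * d * y * v := by ring
    rw [e, t3]
    have t1' := (abs_le.1 t1).1
    have t2' := (abs_le.1 t2).2
    have : 0 < |x| ^ 2 * |d| * (|d| - 6 * lam - M * (6 * lam)) := by
      have : 0 < |d| - 6 * lam - M * (6 * lam) := by nlinarith
      have : 0 < |d| := by linarith
      positivity
    nlinarith

lemma inBox_half {K} {z : ℤ × ℤ} (h : InBox (K + 1) z) : InBox K (half z) := by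
  unfold InBox half at *; rw [pow_succ] at h; dsimp only; omega

def lift (a w : ℤ × ℤ) : ℤ × ℤ := (2 * w.1 + a.1 % 2, 2 * w.2 + a.2 % 2)
lemma half_lift (a w) : half (lift a w) = w := by
  unfold half lift; ext <;> dsimp only <;> omega
lemma cls_lift (a w) : cls (lift a w) = cls a := by
  rw [cls_eq_iff]; unfold lift; dsimp only; omega
lemma inBox_lift {K} {a w : ℤ × ℤ} (h : InBox K w) : InBox (K + 1) (lift a w) := by
  unfold InBox lift at *; rw [pow_succ]; dsimp only; omega
lemma lift_half {a b : ℤ × ℤ} (h : cls a = cls b) : b = lift a (half b) := by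
  rw [cls_eq_iff] at h
  unfold half lift; ext <;> dsimp only <;> omega

lemma ell_lift (a x y) : ell (lift a x) - ell (lift a y) = 2 * (ell x - ell y) := by
  unfold ell lift; push_cast; ring
lemma G_lift (lam : ℝ) (K) (a x y) : G lam (K+1) (lift a x) - G lam (K+1) (lift a y) =
    lam * (G lam K x - G lam K y) := by
  simp only [G, cls_lift, half_lift]; ring
lemma D1_lift (lam : ℝ) (K) (a x y z) : D1 lam (K+1) (lift a x) (lift a y) (lift a z) =
    2 * lam * D1 lam K x y z := by
  unfold D1; rw [ell_lift, ell_lift, G_lift, G_lift]; ring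
lemma D0_lift (a x y z) : D0 (lift a x) (lift a y) (lift a z) = 4 * D0 x y z := by
  unfold D0 lift; dsimp only; ring
lemma Btw_lift (a) {x y z} (h : Btw x y z) : Btw (lift a x) (lift a y) (lift a z) := by
  obtain ⟨m, n, hm, hn, h1, h2⟩ := h
  refine ⟨m, n, hm, hn, ?_, ?_⟩ <;> unfold lift <;> dsimp only
  · linear_combination 2 * h1
  · linear_combination 2 * h2

lemma Btw.D0 {p w r} (h : Btw p w r) : D0 p r w = 0 := by
  obtain ⟨m, n, hm, hn, h1, h2⟩ := h
  have : (m + n) * HF.D0 p r w = 0 := by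
    unfold HF.D0; linear_combination (r.1 - p.1) * h2 - (r.2 - p.2) * h1
  rcases mul_eq_zero.1 this with h | h
  · omega
  · exact h

lemma Btw.ell {p w r} (h : Btw p w r) (hl : ell p < ell r) : ell p < ell w ∧ ell w < ell r := by
  obtain ⟨m, n, hm, hn, h1, h2⟩ := h
  have hm' : (0:ℝ) < m := by exact_mod_cast hm
  have hn' : (0:ℝ) < n := by exact_mod_cast hn
  have h1' : ((m:ℝ) + n) * w.1 = m * p.1 + n * r.1 := by exact_mod_cast h1
  have h2' : ((m:ℝ) + n) * w.2 = m * p.2 + n * r.2 := by exact_mod_cast h2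
  have e : ((m:ℝ) + n) * HF.ell w = m * HF.ell p + n * HF.ell r := by
    unfold HF.ell; linear_combination √2 * h1' - h2'
  constructor <;> nlinarith

lemma Btw.inBox {K p w r} (h : Btw p w r) (hp : InBox K p) (hr : InBox K r) : InBox K w := by
  obtain ⟨m, n, hm, hn, h1, h2⟩ := h
  obtain ⟨p1, p2, p3, p4⟩ := hp
  obtain ⟨r1, r2, r3, r4⟩ := hr
  refine ⟨?_, ?_, ?_, ?_⟩ <;> by_contra hc <;> nlinarith

lemma btw_of_ell {p w r : ℤ × ℤ} (h : D0 p r w = 0) (h1 : ell p < ell w) (h2 : ell w < ell r) :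
    Btw p w r := by
  have aux : ∀ (x y z : ℤ), (ell r - ell p) * ((y:ℝ) - x) = (ell w - ell p) * ((z:ℝ) - x) →
      x < z → x < y ∧ y < z := by
    intro x y z e hz
    have hz' : (x:ℝ) < z := by exact_mod_cast hz
    constructor
    · have : (x:ℝ) < y := by
        by_contra hc; push Not at hc
        nlinarith [mul_pos (sub_pos.2 h1) (sub_pos.2 hz')]
      exact_mod_cast this
    · have : (y:ℝ) < z := by
        by_contra hc; push Not at hc
        nlinarith [mul_pos (sub_pos.2 h2) (sub_pos.2 hz')]
      exact_mod_cast this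
  have R1 := ratio1 h
  have R2 := ratio2 h
  have h' := h
  unfold D0 at h'
  rcases lt_trichotomy p.1 r.1 with c | c | c
  · have := aux _ _ _ R1 c
    exact ⟨r.1 - w.1, w.1 - p.1, by omega, by omega, by ring, by linear_combination h'⟩
  · rcases lt_trichotomy p.2 r.2 with d | d | d
    · have := aux _ _ _ R2 d
      exact ⟨r.2 - w.2, w.2 - p.2, by omega, by omega, by linear_combination - h', by ring⟩
    · have : p = r := Prod.ext c d
      rw [this] at h1; linarith
    · have := aux (-p.2) (-w.2) (-r.2) (by push_cast; linarith) (by omega)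
      exact ⟨w.2 - r.2, p.2 - w.2, by omega, by omega, by linear_combination h', by ring⟩
  · have := aux (-p.1) (-w.1) (-r.1) (by push_cast; linarith) (by omega)
    exact ⟨w.1 - r.1, p.1 - w.1, by omega, by omega, by ring, by linear_combination -h'⟩

lemma exists_btw (n : ℕ) : ∀ p r : ℤ × ℤ, (r.1 - p.1).natAbs + (r.2 - p.2).natAbs ≤ n → p ≠ r →
    cls p = cls r → ∃ w, Btw p w r ∧ cls w ≠ cls p := by
  induction n using Nat.strong_induction_on with
  | _ n ih =>
    intro p r hn hne hc
    have hc' := cls_eq_iff.1 hc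
    have hne' : p.1 ≠ r.1 ∨ p.2 ≠ r.2 := by
      by_contra h; push Not at h; exact hne (Prod.ext h.1 h.2)
    set m : ℤ × ℤ := ((p.1 + r.1) / 2, (p.2 + r.2) / 2) with hm
    have m1 : 2 * m.1 = p.1 + r.1 := by simp only [hm]; omega
    have m2 : 2 * m.2 = p.2 + r.2 := by simp only [hm]; omega
    by_cases hcm : cls m = cls p
    · have hmp : p ≠ m := by
        intro h; rw [← h] at m1 m2; omega
      obtain ⟨w, ⟨a, b, ha, hb, h1, h2⟩, hw⟩ := ih ((m.1 - p.1).natAbs + (m.2 - p.2).natAbs) (by omega) p m le_rfl hmp hcm.symm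
      refine ⟨w, ⟨2 * a + b, b, by omega, by omega, ?_, ?_⟩, hw⟩
      · linear_combination 2 * h1 + b * m1
      · linear_combination 2 * h2 + b * m2
    · exact ⟨m, ⟨1, 1, by norm_num, by norm_num, by linarith, by linarith⟩, hcm⟩

lemma exists_btw' {p r : ℤ × ℤ} (hne : p ≠ r) (hc : cls p = cls r) :
    ∃ w, Btw p w r ∧ cls w ≠ cls p := exists_btw _ p r le_rfl hne hc

/-- `w` lies strictly between `p` and `r` and, infinitesimally, on side `s` of `p r`. -/
def Cup (lam : ℝ) (K : ℕ) (s : ℤ) (p w r : ℤ × ℤ) : Prop :=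
  Btw p w r ∧ ell p < ell r ∧ 0 < s * D1 lam K p w r

lemma cup_mk (s : ℤ) {x dd D : ℝ} (hx : 0 < x) (hd : 0 < s * dd) (hs : s = 1 ∨ s = -1)
    (h : 0 < x * dd * D) : 0 < s * D := by
  rcases hs with rfl | rfl
  · push_cast at *
    have : 0 < x * dd := by nlinarith
    have := (mul_pos_iff_of_pos_left this).1 h
    nlinarith
  · push_cast at *
    have : 0 < x * (-dd) := by nlinarith
    have : 0 < (x * (-dd)) * (-D) := by nlinarith
    have := (mul_pos_iff_of_pos_left (by assumption)).1 this
    nlinarith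

lemma H1 {lam : ℝ} {K : ℕ} (h0 : 0 < lam) (h1 : 12 * lam * 2 ^ K < 1) {s : ℤ} (hs : s = 1 ∨ s = -1)
    {p r x : ℤ × ℤ} (hp : InBox K p) (hr : InBox K r) (hl : ell p < ell r)
    (hc : cls p = cls r) (hx : D0 p r x = 0) (hxs : s * cls x < s * cls p) :
    ∃ w, InBox K w ∧ Cup lam K s p w r := by
  have hne : p ≠ r := by rintro rfl; linarith
  obtain ⟨w, hw, hcw⟩ := exists_btw' hne hc
  have hwb := hw.inBox hp hr
  refine ⟨w, hwb, hw, hl, ?_⟩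
  have hpxw : D0 p x w = 0 := by
    have e1 := hw.D0
    have k1 : (r.1 - p.1) * D0 p x w = 0 := by
      unfold D0 at *; linear_combination (x.1 - p.1) * e1 - (w.1 - p.1) * hx
    have k2 : (r.2 - p.2) * D0 p x w = 0 := by
      unfold D0 at *; linear_combination (x.2 - p.2) * e1 - (w.2 - p.2) * hx
    rcases mul_eq_zero.1 k1 with k | k
    · rcases mul_eq_zero.1 k2 with k' | k'
      · exact absurd (Prod.ext (by omega) (by omega)) hne
      · exact k'
    · exact k
  have hcx : cls x = cls w := by
    rcases three_cls hpxw with h | h | h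
    · rw [h] at hxs; omega
    · exact h
    · exact absurd h.symm hcw
  have := signB h0 h1 hp hwb hne hw.D0 hc (Ne.symm hcw)
  have e := D1_swap23 lam K p r w
  refine cup_mk s (x := ell r - ell p) (dd := (cls p : ℝ) - cls w) (by linarith) ?_ hs (by rw [e]; linarith)
  rw [hcx] at hxs
  have : (s:ℝ) * cls w < s * cls p := by exact_mod_cast hxs
  linarith

lemma H2 {lam : ℝ} {K : ℕ} (h0 : 0 < lam) (h1 : 12 * lam * 2 ^ K < 1) {s : ℤ} (hs : s = 1 ∨ s = -1)
    {p q u : ℤ × ℤ} (hp : InBox K p) (hu : InBox K u) (hl : ell p < ell q)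
    (hc : cls p = cls q) (hx : D0 p q u = 0) (hxs : s * cls p < s * cls u) :
    0 < s * D1 lam K p q u := by
  have hne : p ≠ q := by rintro rfl; linarith
  have hcw : cls p ≠ cls u := by intro h; rw [h] at hxs; omega
  have := signB h0 h1 hp hu hne hx hc hcw
  refine cup_mk s (x := ell q - ell p) (dd := (cls u : ℝ) - cls p) (by linarith) ?_ hs this
  have : (s:ℝ) * cls p < s * cls u := by exact_mod_cast hxs
  linarith

/-- collinearity is transitive along a nondegenerate pair -/
lemma coll {a b c d : ℤ × ℤ} (hab : a ≠ b) (h1 : D0 a b c = 0) (h2 : D0 a b d = 0) :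
    D0 a c d = 0 ∧ D0 b c d = 0 := by
  have k1 : (b.1 - a.1) * D0 a c d = 0 := by
    unfold D0 at *; linear_combination (c.1 - a.1) * h2 - (d.1 - a.1) * h1
  have k2 : (b.2 - a.2) * D0 a c d = 0 := by
    unfold D0 at *; linear_combination (c.2 - a.2) * h2 - (d.2 - a.2) * h1
  have h3 : D0 a c d = 0 := by
    rcases mul_eq_zero.1 k1 with k | k
    · rcases mul_eq_zero.1 k2 with k' | k'
      · exact absurd (Prod.ext (by omega) (by omega)) hab
      · exact k'
    · exact k
  refine ⟨h3, ?_⟩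
  unfold D0 at *; linear_combination h3 - h2 + h1

lemma L1 {lam : ℝ} (h0 : 0 < lam) {s : ℤ} (hs : s = 1 ∨ s = -1) (K : ℕ) :
    12 * lam * 2 ^ K < 1 → ∀ a b c d : ℤ × ℤ, InBox K a → InBox K b → InBox K c → InBox K d →
    ell a < ell b → ell b < ell c → ell c < ell d → D0 a b c = 0 → D0 a b d = 0 →
    ∃ p w r, p ∈ ({a, b, c, d} : Set (ℤ × ℤ)) ∧ r ∈ ({a, b, c, d} : Set (ℤ × ℤ)) ∧ InBox K w ∧
      Cup lam K s p w r ∧ (cls a = cls b → cls a = cls c → cls a = cls d → cls w = cls a) := by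
  induction K with
  | zero =>
    intro _ a b c d ha hb _ _ hab
    exfalso
    unfold InBox at ha hb; simp only [pow_zero] at ha hb
    have : a = b := Prod.ext (by omega) (by omega)
    rw [this] at hab; linarith
  | succ K ih =>
    intro h1 a b c d ha hb hc hd hab hbc hcd e1 e2
    have nab : a ≠ b := by rintro rfl; linarith
    by_cases hall : cls a = cls b ∧ cls a = cls c ∧ cls a = cls d
    · obtain ⟨cb, cc, cd⟩ := hall
      have ea := lift_half (rfl : cls a = cls a)
      have eb := lift_half cb
      have ec := lift_half cc
      have ed := lift_half cd
      have h1' : 12 * lam * 2 ^ K < 1 := by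
        rw [pow_succ] at h1
        have : 0 < 12 * lam * 2 ^ K := by positivity
        linarith
      have t1 := ell_lift a (half b) (half a)
      have t2 := ell_lift a (half c) (half b)
      have t3 := ell_lift a (half d) (half c)
      have t4 := D0_lift a (half a) (half b) (half c)
      have t5 := D0_lift a (half a) (half b) (half d)
      rw [← ea, ← eb] at t1 t4 t5
      rw [← eb, ← ec] at t2
      rw [← ec, ← ed] at t3
      rw [← ec] at t4
      rw [← ed] at t5
      obtain ⟨p, w, r, hp, hr, hw, ⟨q1, q2, q3⟩, _⟩ := ih h1' (half a) (half b) (half c) (half d)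
        (inBox_half ha) (inBox_half hb) (inBox_half hc) (inBox_half hd)
        (by linarith) (by linarith) (by linarith) (by omega) (by omega)
      have mem : ∀ p, p ∈ ({half a, half b, half c, half d} : Set (ℤ × ℤ)) →
          lift a p ∈ ({a, b, c, d} : Set (ℤ × ℤ)) := by
        intro p hp
        simp only [Set.mem_insert_iff, Set.mem_singleton_iff] at hp ⊢
        rcases hp with rfl | rfl | rfl | rfl
        · left; exact ea.symm
        · right; left; exact eb.symm
        · right; right; left; exact ec.symm
        · right; right; right; exact ed.symm
      refine ⟨lift a p, lift a w, lift a r, mem _ hp, mem _ hr, inBox_lift hw,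
        ⟨Btw_lift a q1, ?_, ?_⟩, fun _ _ _ => cls_lift a w⟩
      · have := ell_lift a r p; linarith
      · rw [D1_lift]
        have : 0 < 2 * lam * (s * D1 lam K p w r) := by positivity
        linarith
    · -- two classes
      obtain ⟨acd, bcd⟩ := coll nab e1 e2
      suffices h : ∃ p w r, p ∈ ({a, b, c, d} : Set (ℤ × ℤ)) ∧ r ∈ ({a, b, c, d} : Set (ℤ × ℤ)) ∧
          InBox (K+1) w ∧ Cup lam (K+1) s p w r by
        obtain ⟨p, w, r, hp, hr, hw, hcup⟩ := h
        exact ⟨p, w, r, hp, hr, hw, hcup, fun x y z => absurd ⟨x, y, z⟩ hall⟩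
      by_contra hno
      have F1 : ∀ p r x : ℤ × ℤ, p ∈ ({a, b, c, d} : Set (ℤ × ℤ)) → r ∈ ({a, b, c, d} : Set (ℤ × ℤ)) →
          InBox (K+1) p → InBox (K+1) r → ell p < ell r → cls p = cls r → D0 p r x = 0 →
          s * cls p ≤ s * cls x := by
        intro p r x hp hr bp br hl hcl hx
        by_contra hlt; push Not at hlt
        obtain ⟨w, hw, hcup⟩ := H1 h0 h1 hs bp br hl hcl hx hlt
        exact hno ⟨p, w, r, hp, hr, hw, hcup⟩
      have F2 : ∀ p q u : ℤ × ℤ, p ∈ ({a, b, c, d} : Set (ℤ × ℤ)) → u ∈ ({a, b, c, d} : Set (ℤ × ℤ)) →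
          InBox (K+1) p → InBox (K+1) q → InBox (K+1) u → ell p < ell q → ell q < ell u → cls p = cls q →
          D0 p q u = 0 → s * cls u ≤ s * cls p := by
        intro p q u hp hu bp bq bu hl hl2 hcl hx
        by_contra hlt; push Not at hlt
        refine hno ⟨p, q, u, hp, hu, bq, btw_of_ell ?_ hl hl2, by linarith, H2 h0 h1 hs bp bu hl hcl hx hlt⟩
        rw [D0_swap23, hx, neg_zero]
      have F3 : ∀ u p q : ℤ × ℤ, u ∈ ({a, b, c, d} : Set (ℤ × ℤ)) → q ∈ ({a, b, c, d} : Set (ℤ × ℤ)) →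
          InBox (K+1) u → InBox (K+1) p → InBox (K+1) q → ell u < ell p → ell p < ell q → cls p = cls q →
          D0 u p q = 0 → s * cls u ≤ s * cls p := by
        intro u p q hu hq bu bp bq hl hl2 hcl hx
        by_contra hlt; push Not at hlt
        refine hno ⟨u, p, q, hu, hq, bp, btw_of_ell ?_ hl hl2, by linarith, ?_⟩
        · rw [D0_swap23, hx, neg_zero]
        · rw [← D1_cyc]; exact H2 h0 h1 hs bp bu hl2 hcl (by rw [D0_cyc]; exact hx) hlt
      have ma : a ∈ ({a, b, c, d} : Set (ℤ × ℤ)) := by simp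
      have mb : b ∈ ({a, b, c, d} : Set (ℤ × ℤ)) := by simp
      have mc : c ∈ ({a, b, c, d} : Set (ℤ × ℤ)) := by simp
      have md : d ∈ ({a, b, c, d} : Set (ℤ × ℤ)) := by simp
      have scancel : ∀ x y : ℤ, s * x ≤ s * y → s * y ≤ s * x → x = y := by
        intro x y; rcases hs with rfl | rfl <;> omega
      rcases three_cls e1 with h | h | h
      · have i1 := F1 a b c ma mb ha hb hab h e1
        have i2 := F1 a b d ma mb ha hb hab h e2
        have i3 := F2 a b c ma mc ha hb hc hab hbc h e1
        have i4 := F2 a b d ma md ha hb hd hab (by linarith) h e2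
        exact hall ⟨h, scancel _ _ i1 i3, scancel _ _ i2 i4⟩
      · have i1 := F1 b c a mb mc hb hc hbc h (by rw [D0_cyc]; exact e1)
        have i2 := F1 b c d mb mc hb hc hbc h bcd
        have i3 := F3 a b c ma mc ha hb hc hab hbc h e1
        have i4 := F2 b c d mb md hb hc hd hbc hcd h bcd
        have j1 := scancel _ _ i1 i3
        have j2 := scancel _ _ i2 i4
        exact hall ⟨j1.symm, j1.symm.trans h, j1.symm.trans j2⟩
      · have acb : D0 a c b = 0 := by rw [D0_swap23, e1, neg_zero]
        have i1 := F1 a c b ma mc ha hc (by linarith) h acb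
        have i2 := F1 a c d ma mc ha hc (by linarith) h acd
        have i4 := F2 a c d ma md ha hc hd (by linarith) hcd h acd
        have j2 := scancel _ _ i2 i4
        have i5 := F3 b c d mb md hb hc hd hbc hcd (by rw [← h, j2]) bcd
        rw [← h] at i5
        exact hall ⟨scancel _ _ i1 i5, h, j2⟩

lemma D1_ne {lam : ℝ} (h0 : 0 < lam) (K : ℕ) :
    12 * lam * 2 ^ K < 1 → ∀ a b c : ℤ × ℤ, InBox K a → InBox K b → InBox K c →
    a ≠ b → b ≠ c → a ≠ c → D0 a b c = 0 → D1 lam K a b c ≠ 0 := by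
  induction K with
  | zero =>
    intro _ a b c ha hb hc hab
    exfalso
    unfold InBox at ha hb; simp only [pow_zero] at ha hb
    exact hab (Prod.ext (by omega) (by omega))
  | succ K ih =>
    intro h1 a b c ha hb hc hab hbc hac h
    have B : ∀ a b c : ℤ × ℤ, InBox (K+1) a → InBox (K+1) c → a ≠ b → D0 a b c = 0 → cls a = cls b →
        cls a ≠ cls c → D1 lam (K+1) a b c ≠ 0 := by
      intro a b c ha hc hab h e1 e2 hz
      have := signB h0 h1 ha hc hab h e1 e2
      rw [hz] at this; simp at this
    by_cases hall : cls a = cls b ∧ cls a = cls c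
    · obtain ⟨cb, cc⟩ := hall
      have ea := lift_half (rfl : cls a = cls a)
      have eb := lift_half cb
      have ec := lift_half cc
      have h1' : 12 * lam * 2 ^ K < 1 := by
        rw [pow_succ] at h1
        have : 0 < 12 * lam * 2 ^ K := by positivity
        linarith
      have t4 := D0_lift a (half a) (half b) (half c)
      have t5 := D1_lift lam K a (half a) (half b) (half c)
      rw [← ea, ← eb, ← ec] at t4 t5
      have := ih h1' (half a) (half b) (half c) (inBox_half ha) (inBox_half hb) (inBox_half hc)
        (fun h => hab (by rw [ea, eb, h])) (fun h => hbc (by rw [eb, ec, h]))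
        (fun h => hac (by rw [ea, ec, h])) (by omega)
      rw [t5]; positivity
    · rcases three_cls h with e | e | e
      · exact B a b c ha hc hab h e (fun h' => hall ⟨e, h'⟩)
      · rw [← D1_cyc]
        exact B b c a hb ha hbc (by rw [D0_cyc]; exact h) e (fun h' => hall ⟨h'.symm, h'.symm.trans e⟩)
      · intro hz
        refine B a c b ha hb hac (by rw [D0_swap23, h, neg_zero]) e (fun h' => hall ⟨h', e⟩) ?_
        rw [D1_swap23, hz, neg_zero]

lemma sorted4 (s : Finset (ℤ × ℤ)) (h : 4 ≤ s.card) : ∃ a ∈ s, ∃ b ∈ s, ∃ c ∈ s, ∃ d ∈ s,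
    ell a < ell b ∧ ell b < ell c ∧ ell c < ell d := by
  have step : ∀ s : Finset (ℤ × ℤ), 1 ≤ s.card → ∃ a ∈ s, (∀ x ∈ s.erase a, ell a < ell x) ∧
      (s.erase a).card = s.card - 1 := by
    intro s hs
    obtain ⟨a, ha, hmin⟩ := s.exists_min_image ell (Finset.card_pos.1 (by omega))
    refine ⟨a, ha, fun x hx => ?_, Finset.card_erase_of_mem ha⟩
    rw [Finset.mem_erase] at hx
    exact lt_of_le_of_ne (hmin x hx.2) (fun h => hx.1 (ell_inj h.symm))
  obtain ⟨a, ha, fa, ca⟩ := step s (by omega)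
  obtain ⟨b, hb, fb, cb⟩ := step _ (by omega : 1 ≤ (s.erase a).card)
  obtain ⟨c, hc, fc, cc⟩ := step _ (by omega : 1 ≤ ((s.erase a).erase b).card)
  obtain ⟨d, hd, fd, cd⟩ := step _ (by omega : 1 ≤ (((s.erase a).erase b).erase c).card)
  have hb' := Finset.mem_of_mem_erase hb
  have hc' := Finset.mem_of_mem_erase (Finset.mem_of_mem_erase hc)
  have hd' := Finset.mem_of_mem_erase (Finset.mem_of_mem_erase (Finset.mem_of_mem_erase hd))
  exact ⟨a, ha, b, hb', c, hc', d, hd', fa b hb, fb c hc, fc d hd⟩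

end HF

namespace HF

lemma coll3 {a b x y z : ℤ × ℤ} (hab : a ≠ b) (h1 : D0 a b x = 0) (h2 : D0 a b y = 0)
    (h3 : D0 a b z = 0) : D0 x y z = 0 := by
  have k1 := (coll hab h1 h2).1
  have k2 := (coll hab h1 h3).1
  have k3 := (coll hab h2 h3).1
  unfold D0 at *; linear_combination k1 + k3 - k2

lemma side {a b p r : ℤ × ℤ} (h1 : D0 a b p = 0) (h2 : D0 a b r = 0) (q : ℤ × ℤ) :
    (ell r - ell p) * (D0 a b q : ℝ) = (ell b - ell a) * (D0 p r q : ℝ) := by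
  have h1' : ((D0 a b p : ℤ) : ℝ) = 0 := by rw [h1]; simp
  have h2' : ((D0 a b r : ℤ) : ℝ) = 0 := by rw [h2]; simp
  unfold D0 at *; push_cast at *
  unfold ell
  linear_combination (√2 * (r.1 - p.1) - (r.2 - p.2)) * h1' +
    (√2 * (q.1 - p.1) - (q.2 - p.2)) * (h2' - h1')

lemma L2 {lam : ℝ} (h0 : 0 < lam) (K : ℕ) :
    12 * lam * 2 ^ K < 1 → ∀ Z : Finset (ℤ × ℤ), 7 ≤ Z.card → (∀ z ∈ Z, InBox K z) →
    (∀ a ∈ Z, ∀ b ∈ Z, ∀ c ∈ Z, D0 a b c = 0) →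
    ∃ w, InBox K w ∧ ∃ p ∈ Z, ∃ q ∈ Z, ∃ r ∈ Z,
      (D0 p q w = 0 ∧ D0 q r w = 0 ∧ D0 r p w = 0) ∧
      (0 < D1 lam K p q w ∧ 0 < D1 lam K q r w ∧ 0 < D1 lam K r p w) := by
  induction K with
  | zero =>
    intro _ Z hc hb _
    exfalso
    have : Z.card ≤ 1 := by
      rw [Finset.card_le_one]
      intro a ha b hb'
      have ha := hb a ha
      have hb := hb b hb'
      unfold InBox at ha hb; simp only [pow_zero] at ha hb
      exact Prod.ext (by omega) (by omega)
    omega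
  | succ K ih =>
    intro h1 Z hcard hbox hcol
    by_cases hall : ∃ a ∈ Z, ∀ z ∈ Z, cls a = cls z
    · obtain ⟨a, haZ, ha⟩ := hall
      have h1' : 12 * lam * 2 ^ K < 1 := by
        rw [pow_succ] at h1
        have : 0 < 12 * lam * 2 ^ K := by positivity
        linarith
      have hl : ∀ z ∈ Z, lift a (half z) = z := fun z hz => (lift_half (ha z hz)).symm
      have hci : (Z.image half).card = Z.card := by
        apply Finset.card_image_of_injOn
        intro x hx y hy hxy
        rw [← hl x hx, ← hl y hy, hxy]
      obtain ⟨w, hw, p, hp, q, hq, r, hr, ⟨c1, c2, c3⟩, d1, d2, d3⟩ := ih h1' (Z.image half) (by omega)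
        (by
          intro z hz
          obtain ⟨y, hy, rfl⟩ := Finset.mem_image.1 hz
          exact inBox_half (hbox y hy))
        (by
          intro x hx y hy z hz
          obtain ⟨x, hx', rfl⟩ := Finset.mem_image.1 hx
          obtain ⟨y, hy', rfl⟩ := Finset.mem_image.1 hy
          obtain ⟨z, hz', rfl⟩ := Finset.mem_image.1 hz
          have := D0_lift a (half x) (half y) (half z)
          rw [hl x hx', hl y hy', hl z hz', hcol x hx' y hy' z hz'] at this
          omega)
      have mem : ∀ p ∈ Z.image half, lift a p ∈ Z := by
        intro p hp
        obtain ⟨y, hy, rfl⟩ := Finset.mem_image.1 hp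
        rw [hl y hy]; exact hy
      refine ⟨lift a w, inBox_lift hw, lift a p, mem p hp, lift a q, mem q hq, lift a r, mem r hr, ?_, ?_⟩
      · simp only [D0_lift]; omega
      · simp only [D1_lift]
        exact ⟨by positivity, by positivity, by positivity⟩
    · -- two classes
      have main : ∀ (C : ℤ) (y : ℤ × ℤ), y ∈ Z → cls y ≠ C → 4 ≤ (Z.filter (fun z => cls z = C)).card →
          ∃ w, InBox (K+1) w ∧ ∃ p ∈ Z, ∃ q ∈ Z, ∃ r ∈ Z,
          (D0 p q w = 0 ∧ D0 q r w = 0 ∧ D0 r p w = 0) ∧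
          (0 < D1 lam (K+1) p q w ∧ 0 < D1 lam (K+1) q r w ∧ 0 < D1 lam (K+1) r p w) := by
        intro C y hy hyC h4
        obtain ⟨a, ha, b, hb, c, hc, d, hd, hab, hbc, hcd⟩ := sorted4 _ h4
        rw [Finset.mem_filter] at ha hb hc hd
        obtain ⟨s, hs, hsy⟩ : ∃ s : ℤ, (s = 1 ∨ s = -1) ∧ s * cls y < s * C := by
          rcases lt_or_gt_of_ne hyC with h | h
          · exact ⟨1, by simp, by omega⟩
          · exact ⟨-1, by simp, by omega⟩
        obtain ⟨p, w, r, hp, hr, hw, ⟨hbt, hpr, hD⟩, hcl⟩ := L1 h0 hs (K+1) h1 a b c d (hbox a ha.1) (hbox b hb.1)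
          (hbox c hc.1) (hbox d hd.1) hab hbc hcd (hcol _ ha.1 _ hb.1 _ hc.1) (hcol _ ha.1 _ hb.1 _ hd.1)
        have hcw : cls w = C := by
          rw [hcl (by rw [ha.2, hb.2]) (by rw [ha.2, hc.2]) (by rw [ha.2, hd.2]), ha.2]
        have mem : ∀ p, p ∈ ({a, b, c, d} : Set (ℤ × ℤ)) → p ∈ Z ∧ cls p = C := by
          intro p hp
          simp only [Set.mem_insert_iff, Set.mem_singleton_iff] at hp
          rcases hp with rfl | rfl | rfl | rfl
          · exact ha
          · exact hb
          · exact hc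
          · exact hd
        obtain ⟨hpZ, hpC⟩ := mem p hp
        obtain ⟨hrZ, hrC⟩ := mem r hr
        have npr : p ≠ r := by rintro rfl; linarith
        obtain ⟨l1, l2⟩ := hbt.ell hpr
        have e0 : D0 p r w = 0 := hbt.D0
        have ey : D0 p r y = 0 := hcol _ hpZ _ hrZ _ hy
        have er : D0 p r r = 0 := hcol _ hpZ _ hrZ _ hrZ
        have ep : D0 p r p = 0 := hcol _ hpZ _ hrZ _ hpZ
        have hs' : -s = 1 ∨ -s = -1 := by omega
        have A1 : 0 < ((-s : ℤ) : ℝ) * D1 lam (K+1) p r w := by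
          have := D1_swap23 lam (K+1) p r w
          rw [this] at hD
          push_cast; linarith
        have A2 : 0 < ((-s : ℤ) : ℝ) * D1 lam (K+1) r y w := by
          rw [D1_cyc lam (K+1) w r y]
          exact H2 h0 h1 hs' hw (hbox y hy) l2 (by rw [hcw, hrC]) (coll3 npr e0 er ey) (by rw [hcw]; linarith)
        have A3 : 0 < ((-s : ℤ) : ℝ) * D1 lam (K+1) y p w := by
          rw [D1_cyc lam (K+1) w y p, D1_cyc lam (K+1) p w y]
          exact H2 h0 h1 hs' (hbox p hpZ) (hbox y hy) l1 (by rw [hcw, hpC]) (coll3 npr ep e0 ey) (by rw [hpC]; linarith)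
        rcases hs with rfl | rfl
        · refine ⟨w, hw, r, hrZ, p, hpZ, y, hy, ⟨coll3 npr er ep e0, coll3 npr ep ey e0, coll3 npr ey er e0⟩, ?_⟩
          push_cast at A1 A2 A3
          have s1 : D1 lam (K+1) r p w = - D1 lam (K+1) p r w := by unfold D1; ring
          have s2 : D1 lam (K+1) p y w = - D1 lam (K+1) y p w := by unfold D1; ring
          have s3 : D1 lam (K+1) y r w = - D1 lam (K+1) r y w := by unfold D1; ring
          rw [s1, s2, s3]
          refine ⟨?_, ?_, ?_⟩ <;> linarith
        · refine ⟨w, hw, p, hpZ, r, hrZ, y, hy, ⟨e0, coll3 npr er ey e0, coll3 npr ey ep e0⟩, ?_⟩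
          push_cast at A1 A2 A3
          refine ⟨?_, ?_, ?_⟩ <;> linarith
      push Not at hall
      obtain ⟨a, ha⟩ : Z.Nonempty := Finset.card_pos.1 (by omega)
      obtain ⟨b, hb, hab⟩ := hall a ha
      have hun : Z ⊆ Z.filter (fun z => cls z = cls a) ∪ Z.filter (fun z => cls z = cls b) := by
        intro z hz
        rw [Finset.mem_union, Finset.mem_filter, Finset.mem_filter]
        rcases three_cls (hcol a ha b hb z hz) with h | h | h
        · exact absurd h hab
        · exact Or.inr ⟨hz, h.symm⟩
        · exact Or.inl ⟨hz, h.symm⟩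
      have := (Finset.card_le_card hun).trans (Finset.card_union_le _ _)
      by_cases h4 : 4 ≤ (Z.filter (fun z => cls z = cls a)).card
      · exact main _ b hb (Ne.symm hab) h4
      · exact main _ a ha hab (by omega)

/-- perturbed lattice -/
def phx (lam eps : ℝ) (K : ℕ) (z : ℤ × ℤ) : ℝ := z.1 + eps * G lam K z
def phy (lam eps : ℝ) (K : ℕ) (z : ℤ × ℤ) : ℝ := z.2 + eps * √2 * G lam K z
def X (lam eps : ℝ) (K : ℕ) (a b c : ℤ × ℤ) : ℝ :=
  (phx lam eps K b - phx lam eps K a) * (phy lam eps K c - phy lam eps K a) -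
  (phy lam eps K b - phy lam eps K a) * (phx lam eps K c - phx lam eps K a)

structure Par (lam eps : ℝ) (K : ℕ) : Prop where
  h0 : 0 < lam
  h1 : 12 * lam * 2 ^ K < 1
  he : 0 < eps
  hsm : ∀ a b c : ℤ × ℤ, InBox K a → InBox K b → InBox K c → |eps * D1 lam K a b c| < 1

lemma X_eq (lam eps : ℝ) (K a b c) : X lam eps K a b c = D0 a b c + eps * D1 lam K a b c := by
  unfold X phx phy D0 D1 ell; push_cast; ring

lemma X_swap12 (lam eps : ℝ) (K a b c) : X lam eps K b a c = - X lam eps K a b c := by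
  unfold X; ring

section
variable {lam eps : ℝ} {K : ℕ}

lemma X_pos (P : Par lam eps K) {a b c} (ha : InBox K a) (hb : InBox K b) (hc : InBox K c)
    (h : 0 < D0 a b c) : 0 < X lam eps K a b c := by
  have := (abs_lt.1 (P.hsm a b c ha hb hc)).1
  have h' : (1 : ℝ) ≤ D0 a b c := by exact_mod_cast h
  rw [X_eq]; linarith

lemma X_nonneg (P : Par lam eps K) {a b c} (ha : InBox K a) (hb : InBox K b) (hc : InBox K c)
    (h : 0 ≤ X lam eps K a b c) : 0 ≤ D0 a b c := by
  have := (abs_lt.1 (P.hsm a b c ha hb hc)).2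
  rw [X_eq] at h
  have h' : (-1 : ℝ) < D0 a b c := by linarith
  have : (-1 : ℤ) < D0 a b c := by exact_mod_cast h'
  omega

lemma X_ne (P : Par lam eps K) {a b c} (ha : InBox K a) (hb : InBox K b) (hc : InBox K c)
    (hab : a ≠ b) (hbc : b ≠ c) (hac : a ≠ c) : X lam eps K a b c ≠ 0 := by
  rcases lt_trichotomy (D0 a b c) 0 with h | h | h
  · have := X_pos P hb ha hc (show 0 < D0 b a c by unfold D0 at *; linarith)
    rw [X_swap12] at this; linarith
  · rw [X_eq, h]
    have := D1_ne P.h0 K P.h1 a b c ha hb hc hab hbc hac h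
    have := P.he
    simp only [Int.cast_zero, zero_add]; positivity
  · exact (X_pos P ha hb hc h).ne'

/-- every box point is not interior to the hull of `Z` -/
def Hole (lam eps : ℝ) (K : ℕ) (Z : Finset (ℤ × ℤ)) : Prop :=
  (∀ z ∈ Z, InBox K z) ∧
  ∀ w, InBox K w → ∃ z0 ∈ Z, z0 ≠ w ∧ ∀ z ∈ Z, 0 ≤ X lam eps K w z0 z

variable {Z : Finset (ℤ × ℤ)}

lemma tri (P : Par lam eps K) (H : Hole lam eps K Z) {w p q r : ℤ × ℤ} (hw : InBox K w)
    (hp : p ∈ Z) (hq : q ∈ Z) (hr : r ∈ Z) (h1 : 0 < X lam eps K p q w)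
    (h2 : 0 < X lam eps K q r w) (h3 : 0 < X lam eps K r p w) : False := by
  obtain ⟨z0, hz0, hne, hz⟩ := H.2 w hw
  have a1 := hz p hp
  have a2 := hz q hq
  have a3 := hz r hr
  have e : X lam eps K q r w * X lam eps K w z0 p + X lam eps K r p w * X lam eps K w z0 q +
    X lam eps K p q w * X lam eps K w z0 r = 0 := by unfold X; ring
  have b1 := mul_nonneg h2.le a1
  have b2 := mul_nonneg h3.le a2
  have b3 := mul_nonneg h1.le a3
  have c1 : X lam eps K w z0 p = 0 := by
    rcases mul_eq_zero.1 (by linarith : X lam eps K q r w * X lam eps K w z0 p = 0) with h | h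
    · linarith
    · exact h
  have c2 : X lam eps K w z0 q = 0 := by
    rcases mul_eq_zero.1 (by linarith : X lam eps K r p w * X lam eps K w z0 q = 0) with h | h
    · linarith
    · exact h
  have hwp : w ≠ p := by rintro rfl; unfold X at h1; linarith
  have hwq : w ≠ q := by rintro rfl; unfold X at h1; linarith
  have hpq : p ≠ q := by rintro rfl; unfold X at h1; linarith
  by_cases hzp : z0 = p
  · exact X_ne P hw (H.1 _ hz0) (H.1 _ hq) hne.symm (by rw [hzp]; exact hpq) hwq c2
  · exact X_ne P hw (H.1 _ hz0) (H.1 _ hp) hne.symm hzp hwp c1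

lemma flat (P : Par lam eps K) (H : Hole lam eps K Z) (hc : 7 ≤ Z.card)
    (hcol : ∀ a ∈ Z, ∀ b ∈ Z, ∀ c ∈ Z, D0 a b c = 0) : False := by
  obtain ⟨w, hw, p, hp, q, hq, r, hr, ⟨c1, c2, c3⟩, d1, d2, d3⟩ := L2 P.h0 K P.h1 Z hc H.1 hcol
  have := P.he
  refine tri P H hw hp hq hr ?_ ?_ ?_ <;> rw [X_eq]
  · rw [c1]; simp only [Int.cast_zero, zero_add]; positivity
  · rw [c2]; simp only [Int.cast_zero, zero_add]; positivity
  · rw [c3]; simp only [Int.cast_zero, zero_add]; positivity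

lemma I2 (P : Par lam eps K) (H : Hole lam eps K Z) {p w r q : ℤ × ℤ} (hw : InBox K w)
    (hp : p ∈ Z) (hq : q ∈ Z) (hr : r ∈ Z) (hb : Btw p w r) (h1 : 0 < D0 p r q)
    (h2 : 0 < D1 lam K p r w) : False := by
  have e0 := hb.D0
  obtain ⟨m, n, hm, hn, k1, k2⟩ := hb
  have f1 : (m + n) * D0 r q w = m * D0 p r q := by
    unfold D0 at *; linear_combination (r.2 - q.2) * k1 - (r.1 - q.1) * k2
  have f2 : (m + n) * D0 q p w = n * D0 p r q := by
    unfold D0 at *; linear_combination (q.2 - p.2) * k1 - (q.1 - p.1) * k2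
  have := P.he
  refine tri P H hw hp hr hq ?_ ?_ ?_
  · rw [X_eq, e0]; simp only [Int.cast_zero, zero_add]; positivity
  · refine X_pos P (H.1 _ hr) (H.1 _ hq) hw ?_
    by_contra hc; push Not at hc
    nlinarith [mul_pos hm h1]
  · refine X_pos P (H.1 _ hq) (H.1 _ hp) hw ?_
    by_contra hc; push Not at hc
    nlinarith [mul_pos hn h1]

lemma N3 (P : Par lam eps K) (H : Hole lam eps K Z) {a b q : ℤ × ℤ}
    (hab : a ≠ b) (hq : q ∈ Z) (h : D0 a b q ≠ 0) : (Z.filter (fun z => D0 a b z = 0)).card ≤ 3 := by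
  by_contra h4; push Not at h4
  obtain ⟨x1, hx1, x2, hx2, x3, hx3, x4, hx4, l1, l2, l3⟩ := sorted4 _ h4
  rw [Finset.mem_filter] at hx1 hx2 hx3 hx4
  have hla : ell b - ell a ≠ 0 := fun h => hab (ell_inj (by linarith)).symm
  have mem : ∀ p, p ∈ ({x1, x2, x3, x4} : Set (ℤ × ℤ)) → p ∈ Z ∧ D0 a b p = 0 := by
    intro p hp
    simp only [Set.mem_insert_iff, Set.mem_singleton_iff] at hp
    rcases hp with rfl | rfl | rfl | rfl <;> assumption
  have c1 := coll3 hab hx1.2 hx2.2 hx3.2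
  have c2 := coll3 hab hx1.2 hx2.2 hx4.2
  have key := fun (s : ℤ) (hs : s = 1 ∨ s = -1) => L1 P.h0 hs K P.h1 x1 x2 x3 x4 (H.1 _ hx1.1) (H.1 _ hx2.1)
    (H.1 _ hx3.1) (H.1 _ hx4.1) l1 l2 l3 c1 c2
  have hne : (D0 a b q : ℝ) ≠ 0 := by exact_mod_cast h
  rcases lt_or_gt_of_ne (mul_ne_zero hla hne) with hs | hs
  · obtain ⟨p, w, r, hp, hr, hw, ⟨hbt, hpr, hD⟩, -⟩ := key 1 (by simp)
    obtain ⟨hpZ, hp0⟩ := mem p hp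
    obtain ⟨hrZ, hr0⟩ := mem r hr
    have sd := side hp0 hr0 q
    have hneg : (D0 p r q : ℝ) < 0 := by
      by_contra hc; push Not at hc
      have : (ell b - ell a) * ((ell b - ell a) * (D0 p r q : ℝ)) < 0 := by
        rw [← sd]; nlinarith
      nlinarith [mul_nonneg (mul_self_nonneg (ell b - ell a)) hc]
    have hneg' : D0 p r q < 0 := by exact_mod_cast hneg
    have hb' : Btw r w p := by
      obtain ⟨m, n, hm, hn, k1, k2⟩ := hbt
      exact ⟨n, m, hn, hm, by linarith, by linarith⟩
    refine I2 P H hw hrZ hq hpZ hb' (by unfold D0 at *; linarith) ?_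
    push_cast at hD
    have : D1 lam K r p w = D1 lam K p w r := by unfold D1; ring
    rw [this]; linarith
  · obtain ⟨p, w, r, hp, hr, hw, ⟨hbt, hpr, hD⟩, -⟩ := key (-1) (by simp)
    obtain ⟨hpZ, hp0⟩ := mem p hp
    obtain ⟨hrZ, hr0⟩ := mem r hr
    have sd := side hp0 hr0 q
    have hneg : 0 < (D0 p r q : ℝ) := by
      by_contra hc; push Not at hc
      have : 0 < (ell b - ell a) * ((ell b - ell a) * (D0 p r q : ℝ)) := by
        rw [← sd]; nlinarith
      nlinarith [mul_nonneg (mul_self_nonneg (ell b - ell a)) (neg_nonneg.2 hc)]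
    have hneg' : 0 < D0 p r q := by exact_mod_cast hneg
    refine I2 P H hw hpZ hq hrZ hbt hneg' ?_
    push_cast at hD
    have : D1 lam K p r w = - D1 lam K p w r := by unfold D1; ring
    rw [this]; linarith

lemma weak (P : Par lam eps K) (H : Hole lam eps K Z) {w : ℤ × ℤ} (hw : InBox K w) :
    ∃ z0, z0 ≠ w ∧ ∀ z ∈ Z, 0 ≤ D0 w z0 z := by
  obtain ⟨z0, hz0, hne, h⟩ := H.2 w hw
  exact ⟨z0, hne, fun z hz => X_nonneg P hw (H.1 _ hz0) (H.1 _ hz) (h z hz)⟩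

lemma btw_D0 {p w r : ℤ × ℤ} (h : Btw p w r) (x y : ℤ × ℤ) (h1 : 0 ≤ D0 x y p) (h2 : 0 ≤ D0 x y r) :
    0 ≤ D0 x y w ∧ (D0 x y w = 0 → D0 x y p = 0 ∧ D0 x y r = 0) := by
  obtain ⟨m, n, hm, hn, k1, k2⟩ := h
  have e : (m + n) * D0 x y w = m * D0 x y p + n * D0 x y r := by
    unfold D0; linear_combination (y.1 - x.1) * k2 - (y.2 - x.2) * k1
  constructor
  · by_contra hc; push Not at hc; nlinarith [mul_nonneg hm.le h1, mul_nonneg hn.le h2]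
  · intro h0
    rw [h0] at e
    constructor <;> by_contra hc
    · have : 0 < D0 x y p := by omega
      nlinarith [mul_pos hm this, mul_nonneg hn.le h2]
    · have : 0 < D0 x y r := by omega
      nlinarith [mul_pos hn this, mul_nonneg hm.le h1]

lemma N2 (P : Par lam eps K) (H : Hole lam eps K Z) {p w r : ℤ × ℤ} (hp : p ∈ Z) (hr : r ∈ Z)
    (hb : Btw p w r) {q : ℤ × ℤ} (hq : q ∈ Z) (hqp : 0 < D0 p r q) :
    ∀ z ∈ Z, 0 ≤ D0 p r z := by
  obtain ⟨z0, hne, hz⟩ := weak P H (hb.inBox (H.1 _ hp) (H.1 _ hr))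
  have hw0 : D0 w z0 w = 0 := by unfold D0; ring
  obtain ⟨a1, a2⟩ := (btw_D0 hb w z0 (hz p hp) (hz r hr)).2 hw0
  intro z hzZ
  have s1 := side a1 a2 z
  have s2 := side a1 a2 q
  have hl : ell z0 - ell w ≠ 0 := fun h => hne (ell_inj (by linarith))
  have b1 : (0:ℝ) ≤ D0 w z0 z := by exact_mod_cast hz z hzZ
  have b2 : (0:ℝ) ≤ D0 w z0 q := by exact_mod_cast hz q hq
  have b3 : (0:ℝ) < D0 p r q := by exact_mod_cast hqp
  have : (0:ℝ) ≤ D0 p r z := by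
    set A := ell r - ell p
    set B := ell z0 - ell w
    by_contra hc; push Not at hc
    rcases lt_or_gt_of_ne hl with h | h
    · have : 0 < B * (D0 p r z : ℝ) := mul_pos_of_neg_of_neg h hc
      have : B * (D0 p r q : ℝ) < 0 := mul_neg_of_neg_of_pos h b3
      have hA : A < 0 := by by_contra hA; push Not at hA; nlinarith
      nlinarith
    · have : B * (D0 p r z : ℝ) < 0 := mul_neg_of_pos_of_neg h hc
      have : 0 < B * (D0 p r q : ℝ) := mul_pos h b3
      have hA : 0 < A := by by_contra hA; push Not at hA; nlinarith
      nlinarith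
  exact_mod_cast this

lemma N4 (P : Par lam eps K) (H : Hole lam eps K Z) {a1 r1 b1 a2 r2 b2 : ℤ × ℤ}
    (ha1 : a1 ∈ Z) (hb1 : b1 ∈ Z) (ha2 : a2 ∈ Z) (hb2 : b2 ∈ Z) (h1 : Btw a1 r1 b1) (h2 : Btw a2 r2 b2)
    (hc : cls r1 = cls r2) : D0 a1 b1 a2 = 0 ∧ D0 a1 b1 b2 = 0 := by
  have hc' := cls_eq_iff.1 hc
  set m : ℤ × ℤ := ((r1.1 + r2.1) / 2, (r1.2 + r2.2) / 2) with hm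
  have m1 : 2 * m.1 = r1.1 + r2.1 := by simp only [hm]; omega
  have m2 : 2 * m.2 = r1.2 + r2.2 := by simp only [hm]; omega
  have hbm : Btw r1 m r2 := ⟨1, 1, by norm_num, by norm_num, by linarith, by linarith⟩
  obtain ⟨z0, hne, hz⟩ := weak P H (hbm.inBox (h1.inBox (H.1 _ ha1) (H.1 _ hb1)) (h2.inBox (H.1 _ ha2) (H.1 _ hb2)))
  have e1 := btw_D0 h1 m z0 (hz _ ha1) (hz _ hb1)
  have e2 := btw_D0 h2 m z0 (hz _ ha2) (hz _ hb2)
  obtain ⟨f1, f2⟩ := (btw_D0 hbm m z0 e1.1 e2.1).2 (by unfold D0; ring)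
  obtain ⟨g1, g2⟩ := e1.2 f1
  obtain ⟨g3, g4⟩ := e2.2 f2
  exact ⟨coll3 hne.symm g1 g2 g3, coll3 hne.symm g1 g2 g4⟩

lemma caseA (P : Par lam eps K) (H : Hole lam eps K Z) (hcard : 7 ≤ Z.card) {a b c : ℤ × ℤ}
    (ha : a ∈ Z) (hb : b ∈ Z) (hc : c ∈ Z) (e1 : cls a = cls b) (e2 : cls a = cls c)
    (h : 0 < D0 a b c) : False := by
  have nab : a ≠ b := by rintro rfl; unfold D0 at h; linarith
  have nbc : b ≠ c := by rintro rfl; unfold D0 at h; linarith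
  have nca : c ≠ a := by rintro rfl; unfold D0 at h; linarith
  have hbca : 0 < D0 b c a := by rw [D0_cyc]; exact h
  have hcab : 0 < D0 c a b := by rw [D0_cyc]; exact hbca
  obtain ⟨w1, k1, -⟩ := exists_btw' nab e1
  obtain ⟨w2, k2, -⟩ := exists_btw' nbc (e1.symm.trans e2)
  obtain ⟨w3, k3, -⟩ := exists_btw' nca e2.symm
  have s1 := N2 P H ha hb k1 hc h
  have s2 := N2 P H hb hc k2 ha hbca
  have s3 := N2 P H hc ha k3 hb hcab
  have t1 := N3 P H nab hc h.ne'
  have t2 := N3 P H nbc ha hbca.ne'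
  have t3 := N3 P H nca hb hcab.ne'
  have red : ∀ x y : ℤ × ℤ, x ∈ Z → y ∈ Z → x ≠ y → (Z.filter (fun z => D0 x y z = 0)).card ≤ 3 →
      (Z.filter (fun z => D0 x y z = 0) \ {x, y}).card ≤ 1 := by
    intro x y hx hy hxy h3
    have : ({x, y} : Finset (ℤ × ℤ)) ⊆ Z.filter (fun z => D0 x y z = 0) := by
      intro z hz
      rw [Finset.mem_insert, Finset.mem_singleton] at hz
      rw [Finset.mem_filter]
      rcases hz with rfl | rfl
      · exact ⟨hx, by unfold D0; ring⟩
      · exact ⟨hy, by unfold D0; ring⟩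
    rw [Finset.card_sdiff_of_subset this, Finset.card_pair hxy]; omega
  have u1 := red a b ha hb nab t1
  have u2 := red b c hb hc nbc t2
  have u3 := red c a hc ha nca t3
  have hsub : Z ⊆ ((({a, b, c} : Finset (ℤ × ℤ)) ∪ (Z.filter (fun z => D0 a b z = 0) \ {a, b})) ∪
      (Z.filter (fun z => D0 b c z = 0) \ {b, c})) ∪ (Z.filter (fun z => D0 c a z = 0) \ {c, a}) := by
    intro z hz
    have : D0 a b z = 0 ∨ D0 b c z = 0 ∨ D0 c a z = 0 := by
      by_contra hno
      push Not at hno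
      have q1 := s1 z hz
      have q2 := s2 z hz
      have q3 := s3 z hz
      exact tri P H (H.1 _ hz) ha hb hc (X_pos P (H.1 _ ha) (H.1 _ hb) (H.1 _ hz) (by omega))
        (X_pos P (H.1 _ hb) (H.1 _ hc) (H.1 _ hz) (by omega))
        (X_pos P (H.1 _ hc) (H.1 _ ha) (H.1 _ hz) (by omega))
    simp only [Finset.mem_union, Finset.mem_sdiff, Finset.mem_filter, Finset.mem_insert, Finset.mem_singleton]
    tauto
  have c0 : ({a, b, c} : Finset (ℤ × ℤ)).card ≤ 3 := Finset.card_le_three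
  have := Finset.card_le_card hsub
  have v1 := Finset.card_union_le ((({a, b, c} : Finset (ℤ × ℤ)) ∪ (Z.filter (fun z => D0 a b z = 0) \ {a, b})) ∪
      (Z.filter (fun z => D0 b c z = 0) \ {b, c})) (Z.filter (fun z => D0 c a z = 0) \ {c, a})
  have v2 := Finset.card_union_le (({a, b, c} : Finset (ℤ × ℤ)) ∪ (Z.filter (fun z => D0 a b z = 0) \ {a, b}))
      (Z.filter (fun z => D0 b c z = 0) \ {b, c})
  have v3 := Finset.card_union_le ({a, b, c} : Finset (ℤ × ℤ)) (Z.filter (fun z => D0 a b z = 0) \ {a, b})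
  omega

lemma count (n : ℤ → ℕ) (hsum : n 0 + n 1 + n 2 + n 3 = 7) (ρ : ℤ → ℤ)
    (h : ∀ C, 2 ≤ n C → ρ C ≠ C ∧ n C + n (ρ C) ≤ 3 ∧ 0 ≤ ρ C ∧ ρ C ≤ 3)
    (h2 : ∀ C C', 2 ≤ n C → 2 ≤ n C' → C ≠ C' → ρ C ≠ ρ C') : False := by
  have g : ∀ C, 2 ≤ n C → (ρ C = 0 ∧ C ≠ 0 ∧ n C + n 0 ≤ 3) ∨ (ρ C = 1 ∧ C ≠ 1 ∧ n C + n 1 ≤ 3) ∨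
      (ρ C = 2 ∧ C ≠ 2 ∧ n C + n 2 ≤ 3) ∨ (ρ C = 3 ∧ C ≠ 3 ∧ n C + n 3 ≤ 3) := by
    intro C hC
    obtain ⟨a, b, c, d⟩ := h C hC
    generalize ρ C = x at *
    interval_cases x <;> simp [b, Ne.symm a]
  have g0 := g 0
  have g1 := g 1
  have g2 := g 2
  have g3 := g 3
  have k01 := fun x y => h2 0 1 x y (by norm_num)
  have k02 := fun x y => h2 0 2 x y (by norm_num)
  have k03 := fun x y => h2 0 3 x y (by norm_num)
  have k12 := fun x y => h2 1 2 x y (by norm_num)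
  have k13 := fun x y => h2 1 3 x y (by norm_num)
  have k23 := fun x y => h2 2 3 x y (by norm_num)
  by_cases a0 : 2 ≤ n 0 <;> by_cases a1 : 2 ≤ n 1 <;> by_cases a2 : 2 ≤ n 2 <;> by_cases a3 : 2 ≤ n 3 <;>
    simp only [a0, a1, a2, a3, true_implies, false_implies] at g0 g1 g2 g3 k01 k02 k03 k12 k13 k23 <;>
    clear h h2 g <;> omega

theorem no_hole (P : Par lam eps K) (H : Hole lam eps K Z) (hcard : Z.card = 7) : False := by
  by_cases hflat : ∀ a ∈ Z, ∀ b ∈ Z, ∀ c ∈ Z, D0 a b c = 0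
  · exact flat P H hcard.ge hflat
  have hline : ∀ a ∈ Z, ∀ b ∈ Z, a ≠ b → (Z.filter (fun z => D0 a b z = 0)).card ≤ 3 := by
    intro a ha b hb hab
    by_cases h : ∀ q ∈ Z, D0 a b q = 0
    · exact absurd (fun x hx y hy z hz => coll3 hab (h x hx) (h y hy) (h z hz)) hflat
    · push Not at h
      obtain ⟨q, hq, hq0⟩ := h
      exact N3 P H hab hq hq0
  have hA : ∀ a ∈ Z, ∀ b ∈ Z, ∀ c ∈ Z, cls a = cls b → cls a = cls c → D0 a b c = 0 := by
    intro a ha b hb c hc e1 e2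
    by_contra h
    rcases lt_or_gt_of_ne h with h | h
    · exact caseA P H hcard.ge ha hc hb e2 e1 (by rw [D0_swap23]; omega)
    · exact caseA P H hcard.ge ha hb hc e1 e2 h
  have data : ∀ C : ℤ, ∃ a b r : ℤ × ℤ, 2 ≤ (Z.filter (fun z => cls z = C)).card →
      a ∈ Z ∧ b ∈ Z ∧ cls a = C ∧ cls b = C ∧ a ≠ b ∧ Btw a r b ∧ cls r ≠ C := by
    intro C
    by_cases h : 2 ≤ (Z.filter (fun z => cls z = C)).card
    · obtain ⟨a, ha, b, hb, hab⟩ := Finset.one_lt_card.1 h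
      rw [Finset.mem_filter] at ha hb
      obtain ⟨r, hr, hrc⟩ := exists_btw' hab (ha.2.trans hb.2.symm)
      exact ⟨a, b, r, fun _ => ⟨ha.1, hb.1, ha.2, hb.2, hab, hr, by rw [← ha.2]; exact hrc⟩⟩
    · exact ⟨0, 0, 0, fun h' => absurd h' h⟩
  choose a b r hd using data
  refine count (fun C => (Z.filter (fun z => cls z = C)).card) ?_ (fun C => cls (r C)) ?_ ?_
  · have := Finset.card_eq_sum_card_fiberwise (f := cls) (s := Z) (t := ({0, 1, 2, 3} : Finset ℤ)) (by
      intro z _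
      have := cls_bd z
      simp only [Finset.coe_insert, Finset.coe_singleton, Set.mem_insert_iff, Set.mem_singleton_iff]
      omega)
    rw [hcard] at this
    simp at this
    omega
  · intro C hC
    obtain ⟨haZ, hbZ, hac, hbc, hab, hbt, hrc⟩ := hd C hC
    refine ⟨hrc, ?_, (cls_bd _).1, (cls_bd _).2⟩
    rw [← Finset.card_union_of_disjoint]
    · refine le_trans (Finset.card_le_card ?_) (hline _ haZ _ hbZ hab)
      intro z hz
      rw [Finset.mem_union, Finset.mem_filter, Finset.mem_filter] at hz
      rw [Finset.mem_filter]
      rcases hz with ⟨hz, hzc⟩ | ⟨hz, hzc⟩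
      · exact ⟨hz, hA _ haZ _ hbZ _ hz (hac.trans hbc.symm) (hac.trans hzc.symm)⟩
      · exact ⟨hz, (N4 P H haZ hbZ hz hz hbt ⟨1, 1, by norm_num, by norm_num, by ring, by ring⟩ hzc.symm).1⟩
    · rw [Finset.disjoint_filter]
      intro z _ h1 h2
      exact hrc (h2.symm.trans h1)
  · intro C C' hC hC' hne heq
    obtain ⟨haZ, hbZ, hac, hbc, hab, hbt, hrc⟩ := hd C hC
    obtain ⟨haZ', hbZ', hac', hbc', hab', hbt', hrc'⟩ := hd C' hC'
    obtain ⟨e1, e2⟩ := N4 P H haZ hbZ haZ' hbZ' hbt hbt' heq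
    have hsub : ({a C, b C, a C', b C'} : Finset (ℤ × ℤ)) ⊆ Z.filter (fun z => D0 (a C) (b C) z = 0) := by
      intro z hz
      simp only [Finset.mem_insert, Finset.mem_singleton] at hz
      rw [Finset.mem_filter]
      rcases hz with rfl | rfl | rfl | rfl
      · exact ⟨haZ, by unfold D0; ring⟩
      · exact ⟨hbZ, by unfold D0; ring⟩
      · exact ⟨haZ', e1⟩
      · exact ⟨hbZ', e2⟩
    have d1 : a C ≠ a C' := fun h => hne (by rw [← hac, ← hac', h])
    have d2 : a C ≠ b C' := fun h => hne (by rw [← hac, ← hbc', h])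
    have d3 : b C ≠ a C' := fun h => hne (by rw [← hbc, ← hac', h])
    have d4 : b C ≠ b C' := fun h => hne (by rw [← hbc, ← hbc', h])
    have c4 : ({a C, b C, a C', b C'} : Finset (ℤ × ℤ)).card = 4 := by
      rw [Finset.card_insert_of_notMem (by simp [hab, d1, d2]),
        Finset.card_insert_of_notMem (by simp [d3, d4]), Finset.card_pair hab']
    have := (Finset.card_le_card hsub).trans (hline _ haZ _ hbZ hab)
    omega

end
end HF

namespace HF

/-- orientation determinant of three points of the plane -/
def det3 (p q r : EuclideanSpace ℝ (Fin 2)) : ℝ :=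
  (q 0 - p 0) * (r 1 - p 1) - (q 1 - p 1) * (r 0 - p 0)

lemma ext2 {p q : EuclideanSpace ℝ (Fin 2)} (h0 : p 0 = q 0) (h1 : p 1 = q 1) : p = q := by
  ext i; fin_cases i
  · exact h0
  · exact h1

lemma det_ne_of_gp {S : Set (EuclideanSpace ℝ (Fin 2))} (hS : S.Finite) (h : InGeneralPosition 2 S)
    {p q r : EuclideanSpace ℝ (Fin 2)} (hp : p ∈ S) (hq : q ∈ S) (hr : r ∈ S) (hpq : p ≠ q)
    (hqr : q ≠ r) (hpr : p ≠ r) : det3 p q r ≠ 0 := by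
  intro hd
  have hfr : Module.finrank ℝ (line[ℝ, p, q]).direction = 1 := by
    rw [direction_affineSpan, vectorSpan_pair_rev ℝ p q, ]
    exact finrank_span_singleton (by rw [vsub_eq_sub, sub_ne_zero]; exact hpq.symm)
  have hb := h 1 (by norm_num) _ hfr
  have hrm : r ∈ line[ℝ, p, q] := by
    have : ∃ t : ℝ, r = AffineMap.lineMap p q t := by
      unfold det3 at hd
      by_cases h0 : q 0 - p 0 = 0
      · have h1 : q 1 - p 1 ≠ 0 := fun h1 => hpq (ext2 (by linarith) (by linarith))
        refine ⟨(r 1 - p 1) / (q 1 - p 1), ext2 ?_ ?_⟩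
        · simp [AffineMap.lineMap_apply]
          field_simp
          linear_combination - hd
        · simp [AffineMap.lineMap_apply]
          field_simp
          ring
      · refine ⟨(r 0 - p 0) / (q 0 - p 0), ext2 ?_ ?_⟩
        · simp [AffineMap.lineMap_apply]
          field_simp
          ring
        · simp [AffineMap.lineMap_apply]
          field_simp
          linear_combination hd
    obtain ⟨t, rfl⟩ := this
    exact AffineMap.lineMap_mem_affineSpan_pair t p q
  have hsub : ({p, q, r} : Set (EuclideanSpace ℝ (Fin 2))) ⊆ S ∩ (line[ℝ, p, q] : Set _) := by
    intro x hx
    simp only [Set.mem_insert_iff, Set.mem_singleton_iff] at hx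
    rcases hx with rfl | rfl | rfl
    · exact ⟨hp, left_mem_affineSpan_pair ℝ _ _⟩
    · exact ⟨hq, right_mem_affineSpan_pair ℝ _ _⟩
    · exact ⟨hr, hrm⟩
  have h3 : ({p, q, r} : Set (EuclideanSpace ℝ (Fin 2))).ncard = 3 := by
    rw [Set.ncard_eq_three]
    exact ⟨p, q, r, hpq, hpr, hqr, rfl⟩
  have := Set.ncard_le_ncard hsub (hS.subset Set.inter_subset_left)
  omega

lemma gp_of_det {T : Set (EuclideanSpace ℝ (Fin 2))} (hT : T.Finite)
    (h : ∀ p ∈ T, ∀ q ∈ T, ∀ r ∈ T, p ≠ q → q ≠ r → p ≠ r → det3 p q r ≠ 0) :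
    InGeneralPosition 2 T := by
  intro k hk V hV
  have hfin : (T ∩ (V : Set (EuclideanSpace ℝ (Fin 2)))).Finite := hT.subset Set.inter_subset_left
  have hk' : k = 0 ∨ k = 1 := by omega
  rcases hk' with rfl | rfl
  · rw [Set.ncard_le_one hfin]
    intro a ha b hb
    have hz : V.direction = ⊥ := Submodule.finrank_eq_zero.1 hV
    have := AffineSubspace.vsub_mem_direction ha.2 hb.2
    rw [hz, Submodule.mem_bot, vsub_eq_sub, sub_eq_zero] at this
    exact this
  · by_contra hc
    push Not at hc
    obtain ⟨p, q, r, hp, hq, hr, hpq, hpr, hqr⟩ := (Set.two_lt_ncard_iff hfin).1 hc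
    refine h p hp.1 q hq.1 r hr.1 hpq hqr hpr ?_
    have m1 := AffineSubspace.vsub_mem_direction hq.2 hp.2
    have m2 := AffineSubspace.vsub_mem_direction hr.2 hp.2
    have hne : (⟨q -ᵥ p, m1⟩ : V.direction) ≠ 0 := by
      intro h0
      have : q -ᵥ p = 0 := congrArg Subtype.val h0
      rw [vsub_eq_sub, sub_eq_zero] at this
      exact hpq this.symm
    obtain ⟨c, hc⟩ := (finrank_eq_one_iff_of_nonzero' _ hne).1 hV ⟨r -ᵥ p, m2⟩
    have hc' : c • (q - p) = r - p := congrArg Subtype.val hc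
    have e0 := congrArg (fun v : EuclideanSpace ℝ (Fin 2) => v 0) hc'
    have e1 := congrArg (fun v : EuclideanSpace ℝ (Fin 2) => v 1) hc'
    simp at e0 e1
    unfold det3
    rw [← e0, ← e1]; ring

lemma int_nonempty {A : Set (EuclideanSpace ℝ (Fin 2))} {p q r : EuclideanSpace ℝ (Fin 2)}
    (hp : p ∈ A) (hq : q ∈ A) (hr : r ∈ A) (h : det3 p q r ≠ 0) :
    (interior (convexHull ℝ A)).Nonempty := by
  rw [interior_convexHull_nonempty_iff_affineSpan_eq_top]
  rw [eq_top_iff]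
  intro x _
  have mp := subset_affineSpan ℝ A hp
  have mq := subset_affineSpan ℝ A hq
  have mr := subset_affineSpan ℝ A hr
  have d1 := AffineSubspace.vsub_mem_direction mq mp
  have d2 := AffineSubspace.vsub_mem_direction mr mp
  have := AffineSubspace.vadd_mem_of_mem_direction
    (Submodule.add_mem _ (Submodule.smul_mem _ (det3 p x r / det3 p q r) d1)
      (Submodule.smul_mem _ (det3 p q x / det3 p q r) d2)) mp
  convert this using 1
  apply ext2
  · simp
    field_simp
    unfold det3; ring
  · simp
    field_simp
    unfold det3; ring

lemma sep {A : Set (EuclideanSpace ℝ (Fin 2))} {w : EuclideanSpace ℝ (Fin 2)}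
    (hne : (interior (convexHull ℝ A)).Nonempty) (hw : w ∉ interior (convexHull ℝ A)) :
    ∃ α β : ℝ, ¬ (α = 0 ∧ β = 0) ∧ ∀ x ∈ A, 0 ≤ α * (x 0 - w 0) + β * (x 1 - w 1) := by
  have hconv : Convex ℝ (convexHull ℝ A) := convex_convexHull ℝ A
  obtain ⟨f, hf⟩ := geometric_hahn_banach_open_point hconv.interior isOpen_interior hw
  have hrep : ∀ x : EuclideanSpace ℝ (Fin 2), f x = f (EuclideanSpace.single 0 1) * x 0 +
      f (EuclideanSpace.single 1 1) * x 1 := by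
    intro x
    have : x = (x 0) • EuclideanSpace.single 0 (1:ℝ) + (x 1) • EuclideanSpace.single 1 (1:ℝ) := by
      apply ext2 <;> simp
    conv_lhs => rw [this]
    simp; ring
  refine ⟨- f (EuclideanSpace.single 0 1), - f (EuclideanSpace.single 1 1), ?_, ?_⟩
  · rintro ⟨h0, h1⟩
    obtain ⟨y, hy⟩ := hne
    have := hf y hy
    rw [hrep y, hrep w] at this
    rw [neg_eq_zero] at h0 h1
    rw [h0, h1] at this
    simp at this
  · intro x hx
    have hxc : x ∈ closure (interior (convexHull ℝ A)) := by
      rw [hconv.closure_interior_eq_closure_of_nonempty_interior hne]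
      exact subset_closure (subset_convexHull ℝ A hx)
    have hcl : IsClosed {y | f y ≤ f w} := isClosed_le f.continuous continuous_const
    have : x ∈ {y | f y ≤ f w} := by
      refine closure_minimal ?_ hcl hxc
      intro y hy; exact (hf y hy).le
    have : f x ≤ f w := this
    rw [hrep x, hrep w] at this
    linarith

lemma angular {ι : Type*} (x y : ι → ℝ) (α β : ℝ) (hab : ¬ (α = 0 ∧ β = 0)) (Z : Finset ι)
    (hZ : Z.Nonempty) : (∀ i ∈ Z, 0 ≤ α * x i + β * y i) →
    (∀ i ∈ Z, ∀ j ∈ Z, i ≠ j → x i * y j - y i * x j ≠ 0) →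
    ∃ a ∈ Z, ∀ b ∈ Z, 0 ≤ x a * y b - y a * x b := by
  classical
  induction hZ using Finset.Nonempty.cons_induction with
  | singleton a =>
    intro _ _
    refine ⟨a, by simp, fun b hb => ?_⟩
    rw [Finset.mem_singleton] at hb
    rw [hb]; apply le_of_eq; ring
  | cons c s hc hs ih =>
    intro hf hd
    obtain ⟨a, ha, hab'⟩ := ih (fun i hi => hf i (Finset.mem_cons_of_mem hi))
      (fun i hi j hj => hd i (Finset.mem_cons_of_mem hi) j (Finset.mem_cons_of_mem hj))
    rcases le_or_gt 0 (x a * y c - y a * x c) with h | h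
    · refine ⟨a, Finset.mem_cons_of_mem ha, fun b hb => ?_⟩
      rw [Finset.mem_cons] at hb
      rcases hb with rfl | hb
      · exact h
      · exact hab' b hb
    · refine ⟨c, Finset.mem_cons_self _ _, fun b hb => ?_⟩
      rw [Finset.mem_cons] at hb
      rcases hb with rfl | hb
      · apply le_of_eq; ring
      by_cases hba : b = a
      · rw [hba]; linarith
      have fa := hf a (Finset.mem_cons_of_mem ha)
      have fb := hf b (Finset.mem_cons_of_mem hb)
      have fc := hf c (Finset.mem_cons_self _ _)
      have hb1 := hab' b hb
      have dab := hd a (Finset.mem_cons_of_mem ha) b (Finset.mem_cons_of_mem hb) (Ne.symm hba)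
      have hb2 : 0 < x a * y b - y a * x b := lt_of_le_of_ne hb1 (Ne.symm dab)
      have key : (x c * y a - y c * x a) * (α * x b + β * y b) + (x a * y b - y a * x b) * (α * x c + β * y c)
          = (x c * y b - y c * x b) * (α * x a + β * y a) := by ring
      have hca : 0 < x c * y a - y c * x a := by linarith
      have n1 := mul_nonneg hca.le fb
      have n2 := mul_nonneg hb2.le fc
      rcases fa.lt_or_eq with fa | fa
      · by_contra hneg; push Not at hneg
        have := mul_neg_of_neg_of_pos hneg fa
        linarith
      · exfalso
        rw [← fa] at key
        have z1 : α * x b + β * y b = 0 := by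
          rcases mul_eq_zero.1 (by linarith : (x c * y a - y c * x a) * (α * x b + β * y b) = 0) with h | h
          · linarith
          · exact h
        apply hab
        constructor
        · rcases mul_eq_zero.1 (by linear_combination (-y b) * fa - y a * z1 :
            α * (x a * y b - y a * x b) = 0) with h | h
          · exact h
          · linarith
        · rcases mul_eq_zero.1 (by linear_combination x a * z1 + x b * fa :
            β * (x a * y b - y a * x b) = 0) with h | h
          · exact h
          · linarith

/-- the placed perturbed lattice -/
def Phi (lam eps : ℝ) (K : ℕ) (mu t0 t1 : ℝ) (z : ℤ × ℤ) : EuclideanSpace ℝ (Fin 2) :=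
  !₂[t0 + mu * phx lam eps K z, t1 + mu * phy lam eps K z]

lemma Phi0 (lam eps : ℝ) (K : ℕ) (mu t0 t1 : ℝ) (z) :
    Phi lam eps K mu t0 t1 z 0 = t0 + mu * phx lam eps K z := by simp [Phi]
lemma Phi1 (lam eps : ℝ) (K : ℕ) (mu t0 t1 : ℝ) (z) :
    Phi lam eps K mu t0 t1 z 1 = t1 + mu * phy lam eps K z := by simp [Phi]

lemma det_Phi (lam eps : ℝ) (K : ℕ) (mu t0 t1 : ℝ) (a b c) :
    det3 (Phi lam eps K mu t0 t1 a) (Phi lam eps K mu t0 t1 b) (Phi lam eps K mu t0 t1 c) =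
      mu ^ 2 * X lam eps K a b c := by
  unfold det3 X; simp only [Phi0, Phi1]; ring

lemma ph_inj {lam eps : ℝ} {K : ℕ} {a b : ℤ × ℤ} (h1 : phx lam eps K a = phx lam eps K b)
    (h2 : phy lam eps K a = phy lam eps K b) : a = b := by
  apply ell_inj
  unfold phx at h1; unfold phy at h2; unfold ell
  linear_combination √2 * h1 - h2

lemma Phi_inj {lam eps : ℝ} {K : ℕ} {mu t0 t1 : ℝ} (hmu : 0 < mu) :
    Function.Injective (Phi lam eps K mu t0 t1) := by
  intro a b h
  have h0 := congrArg (fun v : EuclideanSpace ℝ (Fin 2) => v 0) h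
  have h1 := congrArg (fun v : EuclideanSpace ℝ (Fin 2) => v 1) h
  simp only [Phi0, Phi1] at h0 h1
  apply ph_inj (lam := lam) (eps := eps) (K := K)
  · exact mul_left_cancel₀ hmu.ne' (by linarith)
  · exact mul_left_cancel₀ hmu.ne' (by linarith)

lemma grid7 {lam eps : ℝ} {K : ℕ} {mu t0 t1 : ℝ} (hmu : 0 < mu) (P : Par lam eps K)
    (Z : Finset (ℤ × ℤ)) (hZ : ∀ z ∈ Z, InBox K z) (hc : Z.card = 7) :
    ∃ w, InBox K w ∧ Phi lam eps K mu t0 t1 w ∈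
      interior (convexHull ℝ (Phi lam eps K mu t0 t1 '' (Z : Set (ℤ × ℤ)))) := by
  classical
  by_contra hno
  push Not at hno
  refine no_hole P (Z := Z) ⟨hZ, fun w hw => ?_⟩ hc
  have hinterior : (interior (convexHull ℝ (Phi lam eps K mu t0 t1 '' (Z : Set (ℤ × ℤ))))).Nonempty := by
    obtain ⟨a, b, c, ha, hb, hcc, hab, hac, hbc⟩ := Finset.two_lt_card_iff.1 (by omega : 2 < Z.card)
    refine int_nonempty (Set.mem_image_of_mem _ ha) (Set.mem_image_of_mem _ hb) (Set.mem_image_of_mem _ hcc) ?_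
    rw [det_Phi]
    exact mul_ne_zero (by positivity) (X_ne P (hZ _ ha) (hZ _ hb) (hZ _ hcc) hab hbc hac)
  obtain ⟨α, β, hne, hf⟩ := sep hinterior (hno w hw)
  obtain ⟨a, ha, hang⟩ := angular (fun z => phx lam eps K z - phx lam eps K w)
    (fun z => phy lam eps K z - phy lam eps K w) α β hne (Z.erase w)
    (Finset.card_pos.1 (by have := Finset.pred_card_le_card_erase (s := Z) (a := w); omega))
    (by
      intro z hz
      have := hf _ (Set.mem_image_of_mem _ (Finset.mem_coe.2 (Finset.mem_of_mem_erase hz)))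
      simp only [Phi0, Phi1] at this
      have e : α * (t0 + mu * phx lam eps K z - (t0 + mu * phx lam eps K w)) +
        β * (t1 + mu * phy lam eps K z - (t1 + mu * phy lam eps K w)) = mu * (α * (phx lam eps K z - phx lam eps K w) +
        β * (phy lam eps K z - phy lam eps K w)) := by ring
      rw [e] at this
      exact (mul_nonneg_iff_of_pos_left hmu).1 this)
    (by
      intro i hi j hj hij
      rw [Finset.mem_erase] at hi hj
      exact X_ne P hw (hZ _ hi.2) (hZ _ hj.2) (Ne.symm hi.1) hij (Ne.symm hj.1))
  rw [Finset.mem_erase] at ha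
  refine ⟨a, ha.2, ha.1, fun z hz => ?_⟩
  by_cases hzw : z = w
  · rw [hzw]; unfold X; apply le_of_eq; ring
  · exact hang z (Finset.mem_erase.2 ⟨hzw, hz⟩)

lemma quad_fin (A B C : ℝ) (h : ¬ (A = 0 ∧ B = 0)) : {t : ℝ | A * t ^ 2 + B * t + C = 0}.Finite := by
  have hp : (Polynomial.C A * Polynomial.X ^ 2 + Polynomial.C B * Polynomial.X + Polynomial.C C) ≠ 0 := by
    intro h0
    apply h
    have c2 := congrArg (fun p => Polynomial.coeff p 2) h0
    have c1 := congrArg (fun p => Polynomial.coeff p 1) h0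
    simp [Polynomial.coeff_X, Polynomial.coeff_C] at c1 c2
    exact ⟨c2, c1⟩
  refine (Polynomial.finite_setOf_isRoot hp).subset ?_
  intro t ht
  simpa [Polynomial.IsRoot] using ht

lemma par_exists (K : ℕ) : ∃ lam eps : ℝ, Par lam eps K ∧ eps ≤ 1 ∧ lam ≤ 1 / 2 := by
  have hp : (1 : ℝ) ≤ 2 ^ K := one_le_pow₀ (by norm_num)
  have hl : (1 : ℝ) / (24 * 2 ^ K) ≤ 1 / 2 := by
    apply one_div_le_one_div_of_le <;> linarith
  have h0 : (0 : ℝ) < 1 / (24 * 2 ^ K) := by positivity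
  refine ⟨1 / (24 * 2 ^ K), 1 / (80 * 2 ^ K), ⟨h0, ?_, by positivity, ?_⟩, ?_, hl⟩
  · field_simp; norm_num
  · intro a b c ha hb hc
    have hell : ∀ x y : ℤ × ℤ, InBox K x → InBox K y → |ell x - ell y| ≤ 3 * 2 ^ K := by
      intro x y hx hy
      obtain ⟨x1, x2, x3, x4⟩ := hx
      obtain ⟨y1, y2, y3, y4⟩ := hy
      have x1 : (0:ℝ) ≤ x.1 := by exact_mod_cast x1
      have x2 : (x.1:ℝ) < 2 ^ K := by exact_mod_cast x2
      have x3 : (0:ℝ) ≤ x.2 := by exact_mod_cast x3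
      have x4 : (x.2:ℝ) < 2 ^ K := by exact_mod_cast x4
      have y1 : (0:ℝ) ≤ y.1 := by exact_mod_cast y1
      have y2 : (y.1:ℝ) < 2 ^ K := by exact_mod_cast y2
      have y3 : (0:ℝ) ≤ y.2 := by exact_mod_cast y3
      have y4 : (y.2:ℝ) < 2 ^ K := by exact_mod_cast y4
      have s0 : 0 ≤ √2 := Real.sqrt_nonneg 2
      have s2 : √2 ≤ 2 := by rw [Real.sqrt_le_left (by norm_num)]; norm_num
      unfold ell
      have e : √2 * (x.1:ℝ) - x.2 - (√2 * y.1 - y.2) = √2 * (x.1 - y.1) + (y.2 - x.2) := by ring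
      rw [e]
      have a1 : |√2 * ((x.1:ℝ) - y.1)| ≤ 2 * 2 ^ K := by
        rw [abs_mul, abs_of_nonneg s0]
        have : |(x.1:ℝ) - y.1| ≤ 2 ^ K := by rw [abs_le]; constructor <;> linarith
        gcongr
      have a2 : |(y.2:ℝ) - x.2| ≤ 2 ^ K := by rw [abs_le]; constructor <;> linarith
      have := abs_add_le (√2 * ((x.1:ℝ) - y.1)) (y.2 - x.2)
      linarith
    have hG : ∀ x y : ℤ × ℤ, |G (1 / (24 * 2 ^ K)) K x - G (1 / (24 * 2 ^ K)) K y| ≤ 6 := by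
      intro x y
      have := G_bd h0 hl K x
      have := G_bd h0 hl K y
      rw [abs_le]; constructor <;> linarith
    have hD : |D1 (1 / (24 * 2 ^ K)) K a b c| ≤ 36 * 2 ^ K := by
      unfold D1
      refine (abs_sub _ _).trans ?_
      rw [abs_mul, abs_mul]
      have m1 := mul_le_mul (hell b a hb ha) (hG c a) (abs_nonneg _) (by positivity)
      have m2 := mul_le_mul (hell c a hc ha) (hG b a) (abs_nonneg _) (by positivity)
      linarith
    rw [abs_mul, abs_of_pos (by positivity)]
    calc 1 / (80 * 2 ^ K) * |D1 (1 / (24 * 2 ^ K)) K a b c| ≤ 1 / (80 * 2 ^ K) * (36 * 2 ^ K) := by gcongr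
      _ < 1 := by field_simp; norm_num
  · rw [div_le_one (by positivity)]; linarith

lemma centers {S : Set (EuclideanSpace ℝ (Fin 2))} (hS : S.Finite) (hgp : InGeneralPosition 2 S) :
    ∃ n : ℕ, ∀ p ∈ S, ∀ q ∈ S, ∀ r ∈ S, p ≠ q → q ≠ r → p ≠ r →
      ∃ c : EuclideanSpace ℝ (Fin 2), |c 0| ≤ n ∧ |c 1| ≤ n ∧
        ∀ x : EuclideanSpace ℝ (Fin 2), |x 0 - c 0| < 1 / ((n:ℝ) + 1) → |x 1 - c 1| < 1 / ((n:ℝ) + 1) →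
          x ∈ interior (convexHull ℝ {p, q, r}) := by
  have ev : ∀ᶠ n : ℕ in Filter.atTop, ∀ p ∈ S, ∀ q ∈ S, ∀ r ∈ S, p ≠ q → q ≠ r → p ≠ r →
      ∃ c : EuclideanSpace ℝ (Fin 2), |c 0| ≤ n ∧ |c 1| ≤ n ∧
        ∀ x : EuclideanSpace ℝ (Fin 2), |x 0 - c 0| < 1 / ((n:ℝ) + 1) → |x 1 - c 1| < 1 / ((n:ℝ) + 1) →
          x ∈ interior (convexHull ℝ {p, q, r}) := by
    rw [Filter.eventually_all_finite hS]; intro p hp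
    rw [Filter.eventually_all_finite hS]; intro q hq
    rw [Filter.eventually_all_finite hS]; intro r hr
    by_cases hd : p ≠ q ∧ q ≠ r ∧ p ≠ r
    · obtain ⟨c, hc⟩ := int_nonempty (A := {p, q, r}) (p := p) (q := q) (r := r) (by simp) (by simp) (by simp)
        (det_ne_of_gp hS hgp hp hq hr hd.1 hd.2.1 hd.2.2)
      obtain ⟨ρ, hρ, hball⟩ := Metric.isOpen_iff.1 isOpen_interior c hc
      have t0 : Filter.Tendsto (fun n : ℕ => 1 / ((n:ℝ) + 1)) Filter.atTop (nhds 0) :=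
        tendsto_one_div_add_atTop_nhds_zero_nat
      filter_upwards [Filter.eventually_ge_atTop ⌈|c 0|⌉₊, Filter.eventually_ge_atTop ⌈|c 1|⌉₊,
        t0.eventually_lt_const (by positivity : 0 < ρ / 2)] with n h0 h1 h2 _ _ _
      refine ⟨c, (Nat.le_ceil _).trans (by exact_mod_cast h0), (Nat.le_ceil _).trans (by exact_mod_cast h1), ?_⟩
      intro x hx0 hx1
      apply hball
      rw [Metric.mem_ball, EuclideanSpace.dist_eq, Real.sqrt_lt' hρ, Fin.sum_univ_two, Real.dist_eq, Real.dist_eq]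
      have b0 : |x 0 - c 0| < ρ / 2 := hx0.trans h2
      have b1 : |x 1 - c 1| < ρ / 2 := hx1.trans h2
      nlinarith [abs_nonneg (x 0 - c 0), abs_nonneg (x 1 - c 1)]
    · exact Filter.Eventually.of_forall fun n h1 h2 h3 => absurd ⟨h1, h2, h3⟩ hd
  exact ev.exists

end HF

namespace HF

def box (K : ℕ) : Finset (ℤ × ℤ) := Finset.Ico 0 (2 ^ K) ×ˢ Finset.Ico 0 (2 ^ K)

lemma mem_box {K : ℕ} {z : ℤ × ℤ} : z ∈ box K ↔ InBox K z := by
  simp [box, InBox, Finset.mem_product, Finset.mem_Ico, and_assoc]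

lemma card_box (K : ℕ) : (box K).card = 2 ^ K * 2 ^ K := by
  rw [box, Finset.card_product, Int.card_Ico]
  have : ((2:ℤ) ^ K - 0).toNat = 2 ^ K := by
    rw [sub_zero, show (2:ℤ) ^ K = ((2 ^ K : ℕ) : ℤ) by push_cast; rfl, Int.toNat_natCast]
  rw [this]

lemma pick_t {S : Set (EuclideanSpace ℝ (Fin 2))} (hS : S.Finite) (lam eps : ℝ) (K : ℕ)
    {mu : ℝ} (hmu : 0 < mu) (R : ℝ) :
    ∃ t : ℝ, 0 < t ∧ t < mu ∧
      (∀ z ∈ box K, ∀ z' ∈ box K, z ≠ z' → ∀ s ∈ S,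
        det3 (Phi lam eps K mu (-R + t) (-R + t ^ 2) z)
          (Phi lam eps K mu (-R + t) (-R + t ^ 2) z') s ≠ 0) ∧
      (∀ s ∈ S, ∀ s' ∈ S, s ≠ s' → ∀ z ∈ box K,
        det3 s s' (Phi lam eps K mu (-R + t) (-R + t ^ 2) z) ≠ 0) := by
  have f1 : (⋃ z ∈ box K, ⋃ z' ∈ box K, ⋃ s ∈ S, {t : ℝ | z ≠ z' ∧
        det3 (Phi lam eps K mu (-R + t) (-R + t ^ 2) z)
          (Phi lam eps K mu (-R + t) (-R + t ^ 2) z') s = 0}).Finite := by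
    refine Set.Finite.biUnion (box K).finite_toSet fun z _ =>
      Set.Finite.biUnion (box K).finite_toSet fun z' _ => Set.Finite.biUnion hS fun s _ => ?_
    by_cases hz : z = z'
    · simp [hz]
    refine (quad_fin (-(mu * (phx lam eps K z' - phx lam eps K z)))
      (mu * (phy lam eps K z' - phy lam eps K z))
      (mu * (phx lam eps K z' - phx lam eps K z) * (s 1 + R - mu * phy lam eps K z) -
        mu * (phy lam eps K z' - phy lam eps K z) * (s 0 + R - mu * phx lam eps K z)) ?_).subset ?_
    · rintro ⟨h0, h1⟩
      apply hz
      apply ph_inj (lam := lam) (eps := eps) (K := K)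
      · have := (mul_eq_zero.1 (neg_eq_zero.1 h0)).resolve_left hmu.ne'
        linarith
      · have := (mul_eq_zero.1 h1).resolve_left hmu.ne'
        linarith
    · rintro t ⟨_, ht⟩
      unfold det3 at ht
      simp only [Phi0, Phi1] at ht
      simp only [Set.mem_setOf_eq]
      linear_combination ht
  have f2 : (⋃ s ∈ S, ⋃ s' ∈ S, ⋃ z ∈ box K, {t : ℝ | s ≠ s' ∧
        det3 s s' (Phi lam eps K mu (-R + t) (-R + t ^ 2) z) = 0}).Finite := by
    refine Set.Finite.biUnion hS fun s _ => Set.Finite.biUnion hS fun s' _ =>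
      Set.Finite.biUnion (box K).finite_toSet fun z _ => ?_
    by_cases hz : s = s'
    · simp [hz]
    refine (quad_fin (s' 0 - s 0) (-(s' 1 - s 1))
      ((s' 0 - s 0) * (-R + mu * phy lam eps K z - s 1) -
        (s' 1 - s 1) * (-R + mu * phx lam eps K z - s 0)) ?_).subset ?_
    · rintro ⟨h0, h1⟩
      exact hz (ext2 (by linarith) (by linarith))
    · rintro t ⟨_, ht⟩
      unfold det3 at ht
      simp only [Phi0, Phi1] at ht
      simp only [Set.mem_setOf_eq]
      linear_combination ht
  obtain ⟨t, ht, hn⟩ := ((Set.Ioo_infinite hmu).diff (f1.union f2)).nonempty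
  refine ⟨t, ht.1, ht.2, ?_, ?_⟩
  · intro z hz z' hz' hne s hs h0
    apply hn
    left
    simp only [Set.mem_iUnion]
    exact ⟨z, hz, z', hz', s, hs, hne, h0⟩
  · intro s hs s' hs' hne z hz h0
    apply hn
    right
    simp only [Set.mem_iUnion]
    exact ⟨s, hs, s', hs', z, hz, hne, h0⟩

lemma det3_rot (p q r : EuclideanSpace ℝ (Fin 2)) : det3 p q r = det3 q r p := by
  unfold det3; ring

/-- rounding one coordinate to the grid -/
lemma round1 {c mu M R n : ℝ} (hmu : 0 < mu) (hc : |c| ≤ n) (hR : R = n + 1)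
    (hM : mu * M = 2 * R) : 0 ≤ ⌊(c + R) / mu⌋ ∧ ((⌊(c + R) / mu⌋ : ℤ) : ℝ) < M ∧
      mu * (⌊(c + R) / mu⌋ : ℤ) ≤ c + R ∧ c + R < mu * (⌊(c + R) / mu⌋ : ℤ) + mu := by
  have h := abs_le.1 hc
  have hl := Int.floor_le ((c + R) / mu)
  have hu := Int.lt_floor_add_one ((c + R) / mu)
  have e : mu * ((c + R) / mu) = c + R := by field_simp
  refine ⟨Int.floor_nonneg.2 (div_nonneg (by linarith [h.1]) hmu.le), hl.trans_lt ?_, ?_, ?_⟩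
  · rw [div_lt_iff₀ hmu]; linarith [h.2]
  · have := mul_le_mul_of_nonneg_left hl hmu.le
    linarith
  · have := mul_lt_mul_of_pos_left hu hmu
    linarith

theorem main (S : Set (EuclideanSpace ℝ (Fin 2))) (hS : S.Finite)
    (hgp : InGeneralPosition 2 S) (N : ℕ) :
    ∃ T : Set (EuclideanSpace ℝ (Fin 2)),
      T.Finite ∧ S ⊆ T ∧ N ≤ T.ncard ∧ InGeneralPosition 2 T ∧ HoleFree 9 T := by
  classical
  obtain ⟨n, hn⟩ := centers hS hgp
  obtain ⟨K, hK⟩ : ∃ K : ℕ, K = N + 40 * (n + 1) ^ 2 := ⟨_, rfl⟩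
  obtain ⟨lam, eps, P, he1, hl⟩ := par_exists K
  have h2K : (40 * (n + 1) ^ 2 : ℝ) < 2 ^ K := by
    have : 40 * (n + 1) ^ 2 < 2 ^ K := lt_of_le_of_lt (by omega) (Nat.lt_two_pow_self (n := K))
    exact_mod_cast this
  obtain ⟨R, hR⟩ : ∃ R : ℝ, R = (n : ℝ) + 1 := ⟨_, rfl⟩
  have hRpos : 0 < R := by rw [hR]; positivity
  have h2p : (0:ℝ) < 2 ^ K := by positivity
  obtain ⟨mu, hmudef⟩ : ∃ mu : ℝ, mu = 2 * R / 2 ^ K := ⟨_, rfl⟩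
  have hmu : 0 < mu := by rw [hmudef]; positivity
  have hM : mu * 2 ^ K = 2 * R := by rw [hmudef]; field_simp
  have hsmall : 20 * mu < 1 / ((n : ℝ) + 1) := by
    rw [← hR, lt_div_iff₀ hRpos, hmudef]
    rw [← hR] at h2K
    rw [show 20 * (2 * R / 2 ^ K) * R = 40 * R ^ 2 / 2 ^ K by ring, div_lt_one h2p]
    exact h2K
  have hmu1 : mu < 1 := by
    have : 1 / ((n : ℝ) + 1) ≤ 1 := by
      rw [div_le_one (by positivity)]; linarith [Nat.cast_nonneg (α := ℝ) n]
    linarith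
  obtain ⟨t, ht0, htmu, hd1, hd2⟩ := pick_t hS lam eps K hmu R
  set F := Phi lam eps K mu (-R + t) (-R + t ^ 2) with hF
  have hinj : Function.Injective F := Phi_inj hmu
  have hBfin : (F '' (box K : Set (ℤ × ℤ))).Finite := (box K).finite_toSet.image F
  refine ⟨S ∪ F '' (box K : Set (ℤ × ℤ)), hS.union hBfin, Set.subset_union_left, ?_, ?_, ?_⟩
  · refine le_trans ?_ (Set.ncard_le_ncard Set.subset_union_right (hS.union hBfin))
    rw [Set.ncard_image_of_injective _ hinj, Set.ncard_coe_finset, card_box]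
    have h1 : K < 2 ^ K := Nat.lt_two_pow_self
    have h2 : N ≤ K := by omega
    nlinarith
  · apply gp_of_det (hS.union hBfin)
    rintro p (hp | ⟨a, ha, rfl⟩) q (hq | ⟨b, hb, rfl⟩) r (hr | ⟨c, hc, rfl⟩) hpq hqr hpr
    · exact det_ne_of_gp hS hgp hp hq hr hpq hqr hpr
    · exact hd2 p hp q hq hpq c hc
    · rw [det3_rot, det3_rot]; exact hd2 r hr p hp hpr.symm b hb
    · rw [det3_rot]; exact hd1 b hb c hc (fun h => hqr (by rw [h])) p hp
    · rw [det3_rot]; exact hd2 q hq r hr hqr a ha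
    · rw [det3_rot, det3_rot]; exact hd1 c hc a ha (fun h => hpr (by rw [h])) q hq
    · exact hd1 a ha b hb (fun h => hpq (by rw [h])) r hr
    · rw [hF, det_Phi]
      exact mul_ne_zero (by positivity) (X_ne P (mem_box.1 ha) (mem_box.1 hb) (mem_box.1 hc)
        (fun h => hpq (by rw [h])) (fun h => hqr (by rw [h])) (fun h => hpr (by rw [h])))
  · intro U hU hUf hU9
    by_cases h3 : 2 < (U ∩ S).ncard
    · obtain ⟨p, q, r, hp, hq, hr, hpq, hpr, hqr⟩ :=
        (Set.two_lt_ncard_iff (hUf.subset Set.inter_subset_left)).1 h3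
      obtain ⟨c, hc0, hc1, hc⟩ := hn p hp.2 q hq.2 r hr.2 hpq hqr hpr
      obtain ⟨a1, a2, a3, a4⟩ := round1 hmu hc0 hR hM
      obtain ⟨b1, b2, b3, b4⟩ := round1 hmu hc1 hR hM
      set z : ℤ × ℤ := (⌊(c 0 + R) / mu⌋, ⌊(c 1 + R) / mu⌋) with hz
      have hzb : z ∈ box K := mem_box.2 ⟨a1, by exact_mod_cast a2, b1, by exact_mod_cast b2⟩
      refine ⟨F z, Or.inr ⟨z, hzb, rfl⟩, ?_⟩
      have hsub : ({p, q, r} : Set (EuclideanSpace ℝ (Fin 2))) ⊆ U := by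
        rintro x (rfl | rfl | rfl)
        · exact hp.1
        · exact hq.1
        · exact hr.1
      refine interior_mono (convexHull_mono hsub) ?_
      obtain ⟨g0, g6⟩ := G_bd P.h0 hl K z
      have he0 := P.he
      have k1 : 0 ≤ eps * G lam K z := by positivity
      have k2 : eps * G lam K z ≤ 6 := by nlinarith
      have s0 : (0:ℝ) ≤ √2 := Real.sqrt_nonneg 2
      have s2 : √2 ≤ 2 := by
        rw [Real.sqrt_le_left (by norm_num)]; norm_num
      have k3 : 0 ≤ √2 * (eps * G lam K z) := by positivity
      have k4 : √2 * (eps * G lam K z) ≤ 12 := by nlinarith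
      have m1 : 0 ≤ mu * (eps * G lam K z) := by positivity
      have m2 : mu * (eps * G lam K z) ≤ mu * 6 := mul_le_mul_of_nonneg_left k2 hmu.le
      have m3 : 0 ≤ mu * (√2 * (eps * G lam K z)) := by positivity
      have m4 : mu * (√2 * (eps * G lam K z)) ≤ mu * 12 := mul_le_mul_of_nonneg_left k4 hmu.le
      have tt : t ^ 2 ≤ t := by nlinarith
      have tt0 : 0 ≤ t ^ 2 := sq_nonneg t
      apply hc
      · rw [hF, Phi0, phx, abs_lt]
        have e : -R + t + mu * ((z.1 : ℝ) + eps * G lam K z) - c 0 =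
          t + (mu * (z.1 : ℝ) - (c 0 + R)) + mu * (eps * G lam K z) := by ring
        rw [e]
        constructor <;> linarith
      · rw [hF, Phi1, phy, abs_lt]
        have e : -R + t ^ 2 + mu * ((z.2 : ℝ) + eps * √2 * G lam K z) - c 1 =
          t ^ 2 + (mu * (z.2 : ℝ) - (c 1 + R)) + mu * (√2 * (eps * G lam K z)) := by ring
        rw [e]
        constructor <;> linarith
    · set Z0 := (box K).filter (fun z => F z ∈ U) with hZ0
      have hcov : U ⊆ (U ∩ S) ∪ F '' (Z0 : Set (ℤ × ℤ)) := by
        intro x hx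
        rcases hU hx with hs | ⟨z, hz, rfl⟩
        · exact Or.inl ⟨hx, hs⟩
        · exact Or.inr ⟨z, by simpa [hZ0] using ⟨hz, hx⟩, rfl⟩
      have hcard : 7 ≤ Z0.card := by
        have h1 := Set.ncard_le_ncard hcov
          ((hUf.subset Set.inter_subset_left).union (Z0.finite_toSet.image F))
        have h2 := Set.ncard_union_le (U ∩ S) (F '' (Z0 : Set (ℤ × ℤ)))
        rw [Set.ncard_image_of_injective _ hinj, Set.ncard_coe_finset] at h2
        omega
      obtain ⟨Z, hZ, hZ7⟩ := Finset.exists_subset_card_eq hcard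
      have hZm : ∀ z ∈ Z, z ∈ box K ∧ F z ∈ U := fun z hz => by
        simpa [hZ0] using hZ hz
      obtain ⟨w, hw, hwi⟩ := grid7 (t0 := -R + t) (t1 := -R + t ^ 2) hmu P Z
        (fun z hz => mem_box.1 (hZm z hz).1) hZ7
      refine ⟨F w, Or.inr ⟨w, mem_box.2 hw, rfl⟩, interior_mono (convexHull_mono ?_) hwi⟩
      rintro _ ⟨z, hz, rfl⟩
      exact (hZm z hz).2

end HF

theorem statement1 (S : Set (EuclideanSpace ℝ (Fin 2))) (hS : S.Finite)
    (hgp : InGeneralPosition 2 S) (N : ℕ) :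
    ∃ T : Set (EuclideanSpace ℝ (Fin 2)),
      T.Finite ∧ S ⊆ T ∧ N ≤ T.ncard ∧ InGeneralPosition 2 T ∧ HoleFree 9 T := by
  exact HF.main S hS hgp N
end
end
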